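/- Let T be a rooted ternary tree with n leaves labeled 1,…,n in left-to-right order, each internal node v carrying strengths 0 < s_{L,v} < s_{C,v} < s_{R,v} with s_{L,v}/s_{C,v} < 1/2 and s_{C,v}/s_{R,v} < 1/2. Then there is a constant C, depending only on the ratios of the strengths at the internal nodes of T and not on n, such that the league hierarchy chain L_3 on S_n has mixing time t(L_3) ≤ C·n^{14}·log n. -/

import Mathlib

open Finset

/-- Total-variation mixing time: the least `T` such that for every starting state `x`
and every `t ≥ T`, the TV distance between `P^t(x, ·)` and `π` is at most `1/4`. -/
noncomputable def mixingTime {Ω : Type*} [Fintype Ω] [DecidableEq Ω]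
    (P : Matrix Ω Ω ℝ) (π : Ω → ℝ) : ℕ :=
  sInf {T : ℕ | ∀ x : Ω, ∀ t : ℕ, T ≤ t →
    (1 / 2) * ∑ y : Ω, |(P ^ t) x y - π y| ≤ 1 / 4}

/-- A rooted ternary tree; each internal node carries strengths
`sL, sC, sR` for its left, center and right child slots. -/
inductive STree : Type
  | leaf : STree
  | node (sL sC sR : ℝ) (l c r : STree) : STree

namespace STree

/-- Number of leaves of a ternary tree. -/
def numLeaves : STree → ℕ
  | .leaf => 1
  | .node _ _ _ l c r => l.numLeaves + c.numLeaves + r.numLeaves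

/-- `pSwap T i j` is the probability `p_{i,j}` (for leaves `i < j`, 0-indexed
left-to-right) of putting `i` ahead of `j`:  `s_{X,v}/(s_{X,v}+s_{Y,v})` where `v` is
the lowest common ancestor, `X` the child slot of `v` containing `j`, `Y` that
containing `i`. -/
noncomputable def pSwap : STree → ℕ → ℕ → ℝ
  | .leaf, _, _ => 0
  | .node sL sC sR l c r, i, j =>
    if j < l.numLeaves then pSwap l i j
    else if i < l.numLeaves then
      if j < l.numLeaves + c.numLeaves then sC / (sC + sL) else sR / (sR + sL)
    else if j < l.numLeaves + c.numLeaves then pSwap c (i - l.numLeaves) (j - l.numLeaves)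
    else if i < l.numLeaves + c.numLeaves then sR / (sR + sC)
    else pSwap r (i - l.numLeaves - c.numLeaves) (j - l.numLeaves - c.numLeaves)

/-- Every internal node has strengths `0 < s_L < s_C < s_R` with
`s_L/s_C < 1/2` and `s_C/s_R < 1/2`. -/
def Valid : STree → Prop
  | .leaf => True
  | .node sL sC sR l c r =>
      0 < sL ∧ sL < sC ∧ sC < sR ∧ sL / sC < 1 / 2 ∧ sC / sR < 1 / 2 ∧
        l.Valid ∧ c.Valid ∧ r.Valid

/-- All strength ratios at internal nodes are bounded by `qb`. -/
def RatioBound (qb : ℝ) : STree → Prop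
  | .leaf => True
  | .node sL sC sR l c r =>
      sL / sC ≤ qb ∧ sC / sR ≤ qb ∧
        l.RatioBound qb ∧ c.RatioBound qb ∧ r.RatioBound qb

/-- `lcaRange T i j` is the (inclusive) interval of 0-indexed leaf positions of the
subtree rooted at the lowest common ancestor of leaves `i ≤ j`. -/
def lcaRange : STree → ℕ → ℕ → ℕ × ℕ
  | .leaf, _, _ => (0, 0)
  | .node _ _ _ l c r, i, j =>
    if j < l.numLeaves then lcaRange l i j
    else if l.numLeaves ≤ i ∧ j < l.numLeaves + c.numLeaves then
      ((lcaRange c (i - l.numLeaves) (j - l.numLeaves)).1 + l.numLeaves,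
       (lcaRange c (i - l.numLeaves) (j - l.numLeaves)).2 + l.numLeaves)
    else if l.numLeaves + c.numLeaves ≤ i then
      ((lcaRange r (i - l.numLeaves - c.numLeaves) (j - l.numLeaves - c.numLeaves)).1
          + l.numLeaves + c.numLeaves,
       (lcaRange r (i - l.numLeaves - c.numLeaves) (j - l.numLeaves - c.numLeaves)).2
          + l.numLeaves + c.numLeaves)
    else (0, l.numLeaves + c.numLeaves + r.numLeaves - 1)

end STree

/-- Transition matrix of the league hierarchy chain `L₃` on `S_n`,
`n` the number of leaves of `T` (leaves labeled `0,…,n-1` left to right). -/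
noncomputable def leagueP (T : STree) :
    Matrix (Equiv.Perm (Fin T.numLeaves)) (Equiv.Perm (Fin T.numLeaves)) ℝ :=
  fun σ τ => (1 / ((T.numLeaves : ℝ) - 1)) *
    ∑ i : Fin T.numLeaves, ∑ j : Fin T.numLeaves,
      if (j : ℕ) = (i : ℕ) + 1 then
        (T.pSwap (min (σ i : ℕ) (σ j : ℕ)) (max (σ i : ℕ) (σ j : ℕ))) *
          (if τ = (if (σ i : ℕ) ≤ (σ j : ℕ) then σ else σ * Equiv.swap i j) then 1 else 0)
        + (1 - T.pSwap (min (σ i : ℕ) (σ j : ℕ)) (max (σ i : ℕ) (σ j : ℕ))) *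
          (if τ = (if (σ i : ℕ) ≤ (σ j : ℕ) then σ * Equiv.swap i j else σ) then 1 else 0)
      else 0

/-- Transition matrix of the chain `M_tree` on `S_n`. -/
noncomputable def treeP (T : STree) :
    Matrix (Equiv.Perm (Fin T.numLeaves)) (Equiv.Perm (Fin T.numLeaves)) ℝ :=
  fun σ τ => (1 / ((T.numLeaves).choose 2 : ℝ)) *
    ∑ i : Fin T.numLeaves, ∑ j : Fin T.numLeaves,
      if i < j then
        if ∀ l, i < l → l < j →
            ¬((T.lcaRange (min (σ i : ℕ) (σ j : ℕ)) (max (σ i : ℕ) (σ j : ℕ))).1 ≤ (σ l : ℕ) ∧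
              (σ l : ℕ) ≤ (T.lcaRange (min (σ i : ℕ) (σ j : ℕ)) (max (σ i : ℕ) (σ j : ℕ))).2) then
          (T.pSwap (min (σ i : ℕ) (σ j : ℕ)) (max (σ i : ℕ) (σ j : ℕ))) *
            (if τ = (if (σ i : ℕ) ≤ (σ j : ℕ) then σ else σ * Equiv.swap i j) then 1 else 0)
          + (1 - T.pSwap (min (σ i : ℕ) (σ j : ℕ)) (max (σ i : ℕ) (σ j : ℕ))) *
            (if τ = (if (σ i : ℕ) ≤ (σ j : ℕ) then σ * Equiv.swap i j else σ) then 1 else 0)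
        else (if τ = σ then 1 else 0)
      else 0

/-- Unnormalized stationary weight common to `L₃` and `M_tree`:
`∏_{u<v, v before u in σ} (1-p_{u,v})/p_{u,v}`. -/
noncomputable def treeW (T : STree) (σ : Equiv.Perm (Fin T.numLeaves)) : ℝ :=
  ∏ u : Fin T.numLeaves, ∏ v : Fin T.numLeaves,
    if u < v ∧ σ.symm v < σ.symm u then
      (1 - T.pSwap (u : ℕ) (v : ℕ)) / T.pSwap (u : ℕ) (v : ℕ)
    else 1

/-- Common stationary distribution of `L₃` and `M_tree`. -/
noncomputable def treePi (T : STree) (σ : Equiv.Perm (Fin T.numLeaves)) : ℝ :=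
  treeW T σ / ∑ τ : Equiv.Perm (Fin T.numLeaves), treeW T τ

section Reorder

variable {n : ℕ}

/-- Unnormalized weight of a permutation: the product of `q u v` over its inversions. -/
noncomputable def permWeight (q : Fin n → Fin n → ℝ) (σ : Equiv.Perm (Fin n)) : ℝ :=
  ∏ u : Fin n, ∏ v : Fin n, if u < v ∧ σ.symm v < σ.symm u then q u v else 1

theorem exists_reorder (V : Finset (Fin n)) (σ τ : Equiv.Perm (Fin n)) :
    ∃ σ' : Equiv.Perm (Fin n), (∀ a, a ∉ V → σ'.symm a = σ.symm a) ∧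
      (∀ a ∈ V, ∀ b ∈ V, (σ'.symm a < σ'.symm b ↔ τ.symm a < τ.symm b)) ∧
      ∀ a ∈ V, σ (σ'.symm a) ∈ V := by
  classical
  have hA : (V.map σ.symm.toEmbedding).card = V.card := by simp
  have hB : (V.map τ.symm.toEmbedding).card = V.card := by simp
  set eA := (V.map σ.symm.toEmbedding).orderIsoOfFin hA
  set eB := (V.map τ.symm.toEmbedding).orderIsoOfFin hB
  have hmem : ∀ a ∈ V, τ.symm a ∈ V.map τ.symm.toEmbedding := fun a ha => by simpa using ha
  have hin : ∀ k, σ (eA k : Fin n) ∈ V := fun k => by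
    have h := (eA k).2
    rw [Finset.mem_map_equiv] at h
    simpa using h
  let g : Fin n → Fin n := fun a =>
    if ha : a ∈ V then (eA (eB.symm ⟨τ.symm a, hmem a ha⟩) : Fin n) else σ.symm a
  have hg : Function.Injective g := by
    intro a b hab
    by_cases ha : a ∈ V <;> by_cases hb : b ∈ V <;> simp only [g, ha, hb, dif_pos, dif_neg,
      not_false_eq_true] at hab
    · simpa using eB.symm.injective (eA.injective (Subtype.ext hab))
    · exact absurd (by rw [hab, Equiv.apply_symm_apply]; exact hb) (not_not.2 (hin _))
    · exact absurd (by rw [← hab, Equiv.apply_symm_apply]; exact ha) (not_not.2 (hin _))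
    · exact σ.symm.injective hab
  refine ⟨(Equiv.ofBijective g (Finite.injective_iff_bijective.1 hg)).symm, ?_, ?_, ?_⟩
  · intro a ha
    simp [g, ha]
  · intro a ha b hb
    simp only [Equiv.symm_symm, Equiv.ofBijective_apply, g, ha, hb, dif_pos]
    rw [Subtype.coe_lt_coe, eA.lt_iff_lt, eB.symm.lt_iff_lt, Subtype.mk_lt_mk]
  · intro a ha
    simp only [Equiv.symm_symm, Equiv.ofBijective_apply, g, ha, dif_pos]
    exact hin _

/-- `reorder V σ τ` rearranges the labels in `V` among the positions they occupy in `σ`, so that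
they appear in the same relative order as in `τ`. -/
noncomputable def reorder (V : Finset (Fin n)) (σ τ : Equiv.Perm (Fin n)) :
    Equiv.Perm (Fin n) :=
  (exists_reorder V σ τ).choose

theorem reorder_symm_of_notMem {V : Finset (Fin n)} (σ τ : Equiv.Perm (Fin n)) {a : Fin n}
    (ha : a ∉ V) : (reorder V σ τ).symm a = σ.symm a :=
  (exists_reorder V σ τ).choose_spec.1 a ha

theorem reorder_lt_iff {V : Finset (Fin n)} (σ τ : Equiv.Perm (Fin n)) {a b : Fin n}
    (ha : a ∈ V) (hb : b ∈ V) :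
    (reorder V σ τ).symm a < (reorder V σ τ).symm b ↔ τ.symm a < τ.symm b :=
  (exists_reorder V σ τ).choose_spec.2.1 a ha b hb

theorem apply_reorder_symm_mem {V : Finset (Fin n)} (σ τ : Equiv.Perm (Fin n)) {a : Fin n}
    (ha : a ∈ V) : σ ((reorder V σ τ).symm a) ∈ V :=
  (exists_reorder V σ τ).choose_spec.2.2 a ha

theorem perm_eq_one_of_moved_strictMono (g : Equiv.Perm (Fin n))
    (h : ∀ i j, g i ≠ i → g j ≠ j → i < j → g i < g j) : g = 1 := by
  by_contra hne
  have hex : ∃ i, g i ≠ i := by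
    by_contra! hall
    exact hne (Equiv.ext hall)
  obtain ⟨i, hi, hmin⟩ := WellFounded.has_min (wellFounded_lt (α := Fin n)) {i | g i ≠ i} hex
  have hmin' : ∀ j, j < i → g j = j := fun j hj => by
    by_contra hc
    exact hmin j hc hj
  have h1 : i < g i := by
    rcases lt_trichotomy (g i) i with hlt | heq | hgt
    · exact absurd (g.injective (hmin' _ hlt)) hi
    · exact absurd heq hi
    · exact hgt
  have hgs : g (g.symm i) = i := g.apply_symm_apply i
  have h2 : g.symm i ≠ i := fun hc => hi (by rw [hc] at hgs; exact hgs)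
  have h3 : i < g.symm i := by
    rcases lt_trichotomy (g.symm i) i with hlt | heq | hgt
    · exact absurd ((hmin' _ hlt).symm.trans hgs) h2
    · exact absurd heq h2
    · exact hgt
  have h4 := h i (g.symm i) hi (by rw [hgs]; exact h2.symm) h3
  rw [hgs] at h4
  exact absurd h4 (not_lt.2 h1.le)

theorem perm_eq_of_agree {V : Finset (Fin n)} {σ τ : Equiv.Perm (Fin n)}
    (h1 : ∀ a, a ∉ V → σ.symm a = τ.symm a)
    (h2 : ∀ a ∈ V, ∀ b ∈ V, (σ.symm a < σ.symm b → τ.symm a < τ.symm b)) : σ = τ := by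
  have hin : ∀ i, (τ.symm (σ i)) ≠ i → σ i ∈ V := by
    intro i hi
    by_contra hc
    exact hi (by rw [← h1 _ hc, Equiv.symm_apply_apply])
  have hg : σ.trans τ.symm = 1 := by
    apply perm_eq_one_of_moved_strictMono
    intro i j hi hj hij
    exact h2 _ (hin i hi) _ (hin j hj) (by simpa using hij)
  ext i
  have := congrArg τ (congrFun (congrArg DFunLike.coe hg) i)
  simpa using congrArg Fin.val this

/-- Exchange the relative orders of the labels in `V` between the two permutations of a pair. -/
noncomputable def exchange (V : Finset (Fin n)) (p : Equiv.Perm (Fin n) × Equiv.Perm (Fin n)) :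
    Equiv.Perm (Fin n) × Equiv.Perm (Fin n) :=
  (reorder V p.1 p.2, reorder V p.2 p.1)

theorem reorder_reorder (V : Finset (Fin n)) (σ τ : Equiv.Perm (Fin n)) :
    reorder V (reorder V σ τ) (reorder V τ σ) = σ := by
  apply perm_eq_of_agree (V := V)
  · intro a ha
    rw [reorder_symm_of_notMem _ _ ha, reorder_symm_of_notMem _ _ ha]
  · intro a ha b hb h
    rwa [reorder_lt_iff _ _ ha hb, reorder_lt_iff _ _ ha hb] at h

theorem exchange_involutive (V : Finset (Fin n)) : Function.Involutive (exchange V) := fun p => by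
  simp only [exchange, reorder_reorder]

/-- `V` is a set of consecutive labels that all other labels compare to in the same way. -/
def IsModule (q : Fin n → Fin n → ℝ) (V : Finset (Fin n)) : Prop :=
  ∀ x ∈ V, ∀ y ∈ V, ∀ u, u ∉ V →
    (x < u ↔ y < u) ∧ (x < u → q x u = q y u) ∧ (u < x → q u x = q u y)

theorem permWeight_eq_mul (q : Fin n → Fin n → ℝ) (V : Finset (Fin n)) (σ : Equiv.Perm (Fin n)) :
    permWeight q σ =
      (∏ z : Fin n × Fin n, if z.1 ∈ V ∧ z.2 ∈ V then
        (if z.1 < z.2 ∧ σ.symm z.2 < σ.symm z.1 then q z.1 z.2 else 1) else 1) *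
      ∏ z : Fin n × Fin n, if z.1 ∈ V ∧ z.2 ∈ V then 1 else
        (if z.1 < z.2 ∧ σ.symm z.2 < σ.symm z.1 then q z.1 z.2 else 1) := by
  rw [← Finset.prod_mul_distrib, permWeight, ← Fintype.prod_prod_type']
  refine Finset.prod_congr rfl fun z _ => ?_
  by_cases h : z.1 ∈ V ∧ z.2 ∈ V
  · rw [if_pos h, if_pos h, mul_one]
  · rw [if_neg h, if_neg h, one_mul]

theorem prod_inside_reorder (q : Fin n → Fin n → ℝ) (V : Finset (Fin n))
    (σ τ : Equiv.Perm (Fin n)) :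
    (∏ z : Fin n × Fin n, if z.1 ∈ V ∧ z.2 ∈ V then
        (if z.1 < z.2 ∧ (reorder V σ τ).symm z.2 < (reorder V σ τ).symm z.1
          then q z.1 z.2 else 1) else 1) =
      ∏ z : Fin n × Fin n, if z.1 ∈ V ∧ z.2 ∈ V then
        (if z.1 < z.2 ∧ τ.symm z.2 < τ.symm z.1 then q z.1 z.2 else 1) else 1 := by
  refine Finset.prod_congr rfl fun z _ => ?_
  by_cases h : z.1 ∈ V ∧ z.2 ∈ V
  · simp only [if_pos h, reorder_lt_iff _ _ h.2 h.1]
  · rw [if_neg h, if_neg h]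

theorem prod_outside_reorder {q : Fin n → Fin n → ℝ} {V : Finset (Fin n)} (hV : IsModule q V)
    (σ τ : Equiv.Perm (Fin n)) :
    (∏ z : Fin n × Fin n, if z.1 ∈ V ∧ z.2 ∈ V then 1 else
        (if z.1 < z.2 ∧ (reorder V σ τ).symm z.2 < (reorder V σ τ).symm z.1
          then q z.1 z.2 else 1)) =
      ∏ z : Fin n × Fin n, if z.1 ∈ V ∧ z.2 ∈ V then 1 else
        (if z.1 < z.2 ∧ σ.symm z.2 < σ.symm z.1 then q z.1 z.2 else 1) := by
  set ν : Equiv.Perm (Fin n) := (reorder V σ τ).symm.trans σ with hν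
  have hfix : ∀ a, a ∉ V → ν a = a := fun a ha => by
    simp [hν, reorder_symm_of_notMem σ τ ha]
  have hmem : ∀ a, a ∈ V → ν a ∈ V := fun a ha => apply_reorder_symm_mem σ τ ha
  have hiff : ∀ a, ν a ∈ V ↔ a ∈ V := fun a =>
    ⟨fun h => by by_contra hc; rw [hfix a hc] at h; exact hc h, hmem a⟩
  have hsymm : ∀ a, σ.symm (ν a) = (reorder V σ τ).symm a := fun a => by simp [hν]
  rw [eq_comm, ← (Equiv.prodCongr ν ν).prod_comp]
  refine Finset.prod_congr rfl fun z _ => ?_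
  simp only [Equiv.prodCongr_apply, Prod.map_fst, Prod.map_snd, hiff, hsymm]
  by_cases h1 : z.1 ∈ V <;> by_cases h2 : z.2 ∈ V
  · simp [h1, h2]
  · obtain ⟨ha, hb, -⟩ := hV _ h1 _ (hmem _ h1) _ h2
    simp only [hfix _ h2, h1, h2, and_false, if_false, ← ha]
    by_cases h3 : z.1 < z.2
    · rw [hb h3]
    · simp [h3]
  · obtain ⟨ha, -, hb⟩ := hV _ h2 _ (hmem _ h2) _ h1
    have ha' : z.1 < z.2 ↔ z.1 < ν z.2 := by
      have e1 : z.1 ≠ z.2 := fun e => h1 (e ▸ h2)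
      have e2 : z.1 ≠ ν z.2 := fun e => h1 (e ▸ hmem _ h2)
      rw [← not_iff_not, not_lt, not_lt, le_iff_lt_or_eq, le_iff_lt_or_eq]
      simp only [e1.symm, e2.symm, or_false, ha]
    simp only [hfix _ h1, h1, h2, false_and, if_false, ← ha']
    by_cases h3 : z.1 < z.2
    · rw [hb h3]
    · simp [h3]
  · simp only [hfix _ h1, hfix _ h2]

theorem permWeight_reorder_mul {q : Fin n → Fin n → ℝ} {V : Finset (Fin n)} (hV : IsModule q V)
    (σ τ : Equiv.Perm (Fin n)) :
    permWeight q (reorder V σ τ) * permWeight q (reorder V τ σ) =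
      permWeight q σ * permWeight q τ := by
  rw [permWeight_eq_mul q V (reorder V σ τ), permWeight_eq_mul q V (reorder V τ σ),
    permWeight_eq_mul q V σ, permWeight_eq_mul q V τ, prod_inside_reorder, prod_inside_reorder,
    prod_outside_reorder hV, prod_outside_reorder hV]
  ring

theorem sum_exchange {q : Fin n → Fin n → ℝ} {V : Finset (Fin n)} (hV : IsModule q V)
    (F : Equiv.Perm (Fin n) × Equiv.Perm (Fin n) → ℝ) :
    ∑ p : Equiv.Perm (Fin n) × Equiv.Perm (Fin n),
        permWeight q p.1 * permWeight q p.2 * F (exchange V p) =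
      ∑ p : Equiv.Perm (Fin n) × Equiv.Perm (Fin n),
        permWeight q p.1 * permWeight q p.2 * F p := by
  rw [eq_comm, ← Equiv.sum_comp ((exchange_involutive V).toPerm _)
    (fun p => permWeight q p.1 * permWeight q p.2 * F p)]
  refine Finset.sum_congr rfl fun p _ => ?_
  simp only [Function.Involutive.coe_toPerm]
  congr 1
  exact permWeight_reorder_mul hV p.1 p.2

end Reorder

section Collapse

variable {Ω : Type*} [Fintype Ω]

theorem sum_iterate_le {W : Ω → ℝ} (hW : ∀ x, 0 ≤ W x) {p : Ω → Ω} {U : Ω → Prop}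
    [DecidablePred U] {θ : ℝ} (hθ : θ < 1) (hp : ∀ x, ¬ U x → p x = x)
    (hK : ∀ φ : Ω → ℝ, (∀ x, 0 ≤ φ x) →
      ∑ x, (if U x then W x * φ (p x) else 0) ≤ θ * ∑ x, W x * φ x)
    {N : ℕ} (hN : ∀ x, ¬ U (p^[N] x)) {h : Ω → ℝ} (hh : ∀ x, 0 ≤ h x) :
    ∑ x, W x * h (p^[N] x) ≤ (1 / (1 - θ)) * ∑ x, W x * h x := by
  have hGp : ∀ x, p^[N] (p x) = p^[N] x := fun x => by
    rw [← Function.iterate_succ_apply, Function.iterate_succ_apply', hp _ (hN x)]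
  have h1 : ∑ x, W x * h (p^[N] x) ≤
      ∑ x, W x * h x + ∑ x, (if U x then W x * h (p^[N] (p x)) else 0) := by
    rw [← Finset.sum_add_distrib]
    refine Finset.sum_le_sum fun x _ => ?_
    by_cases hx : U x
    · simp only [hx, if_true, hGp]
      linarith [mul_nonneg (hW x) (hh x)]
    · have : p^[N] x = x := Function.iterate_fixed (hp x hx) N
      simp [hx, this]
  have h2 := hK (fun x => h (p^[N] x)) fun x => hh _
  have h3 : 0 < 1 - θ := by linarith
  rw [div_mul_eq_mul_div, one_mul, le_div_iff₀ h3]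
  linarith

theorem sum_sub_iterate_sq_le {W : Ω → ℝ} (hW : ∀ x, 0 ≤ W x) {p : Ω → Ω} {U : Ω → Prop}
    [DecidablePred U] {θ : ℝ} (hθ : θ < 1) (hp : ∀ x, ¬ U x → p x = x)
    (hK : ∀ φ : Ω → ℝ, (∀ x, 0 ≤ φ x) →
      ∑ x, (if U x then W x * φ (p x) else 0) ≤ θ * ∑ x, W x * φ x)
    {N : ℕ} (hN : ∀ x, ¬ U (p^[N] x)) (f : Ω → ℝ) :
    ∑ x, W x * (f x - f (p^[N] x)) ^ 2 ≤
      ((1 + 2 / (1 - θ)) * (2 / (1 - θ))) *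
        ∑ x, (if U x then W x * (f x - f (p x)) ^ 2 else 0) := by
  have hGp : ∀ x, p^[N] (p x) = p^[N] x := fun x => by
    rw [← Function.iterate_succ_apply, Function.iterate_succ_apply', hp _ (hN x)]
  obtain ⟨s, hs⟩ : ∃ s, s = (1 - θ) / 2 := ⟨_, rfl⟩
  have hs0 : 0 < s := by rw [hs]; linarith
  have h2s : 2 / (1 - θ) = 1 / s := by rw [hs]; field_simp
  have h1 : ∑ x, W x * (f x - f (p^[N] x)) ^ 2 ≤
      (1 + 1 / s) * ∑ x, (if U x then W x * (f x - f (p x)) ^ 2 else 0) +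
      (1 + s) * ∑ x, (if U x then W x * (f (p x) - f (p^[N] (p x))) ^ 2 else 0) := by
    rw [Finset.mul_sum, Finset.mul_sum, ← Finset.sum_add_distrib]
    refine Finset.sum_le_sum fun x _ => ?_
    by_cases hx : U x
    · simp only [hx, if_true, hGp]
      have key : (f x - f (p^[N] x)) ^ 2 ≤
          (1 + 1 / s) * (f x - f (p x)) ^ 2 + (1 + s) * (f (p x) - f (p^[N] x)) ^ 2 := by
        have : (1 + 1 / s) * (f x - f (p x)) ^ 2 + (1 + s) * (f (p x) - f (p^[N] x)) ^ 2 -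
            (f x - f (p^[N] x)) ^ 2 =
            (1 / s) * ((f x - f (p x)) - s * (f (p x) - f (p^[N] x))) ^ 2 := by
          field_simp
          ring
        have h0 : 0 ≤ (1 / s) * ((f x - f (p x)) - s * (f (p x) - f (p^[N] x))) ^ 2 := by
          positivity
        linarith
      nlinarith [mul_le_mul_of_nonneg_left key (hW x)]
    · have : p^[N] x = x := Function.iterate_fixed (hp x hx) N
      simp [hx, this]
  have h2 := hK (fun x => (f x - f (p^[N] x)) ^ 2) fun x => sq_nonneg _
  have h3 : 0 ≤ ∑ x, W x * (f x - f (p^[N] x)) ^ 2 :=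
    Finset.sum_nonneg fun x _ => mul_nonneg (hW x) (sq_nonneg _)
  rw [h2s, mul_comm (1 + 1 / s), mul_assoc, div_mul_eq_mul_div, one_mul, le_div_iff₀ hs0]
  have h4 : (1 + s) * θ ≤ 1 - s := by
    have : θ = 1 - 2 * s := by rw [hs]; ring
    rw [this]
    nlinarith
  have h5 := mul_le_mul_of_nonneg_left h2 (by linarith : 0 ≤ 1 + s)
  have h6 := mul_le_mul_of_nonneg_right h4 h3
  linarith

end Collapse

section Sorting

variable {m : ℕ}

/-- The transposition of the adjacent positions `i` and `i + 1`. -/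
def adj (i : Fin m) : Equiv.Perm (Fin (m + 1)) := Equiv.swap i.castSucc i.succ

@[simp] theorem adj_castSucc (i : Fin m) : adj i i.castSucc = i.succ := Equiv.swap_apply_left _ _

@[simp] theorem adj_succ (i : Fin m) : adj i i.succ = i.castSucc := Equiv.swap_apply_right _ _

@[simp] theorem adj_adj (i : Fin m) (x : Fin (m + 1)) : adj i (adj i x) = x :=
  Equiv.swap_apply_self _ _ _

@[simp] theorem mul_adj_mul_adj (σ : Equiv.Perm (Fin (m + 1))) (i : Fin m) :
    σ * adj i * adj i = σ := by
  ext x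
  simp

theorem adj_of_ne {i : Fin m} {x : Fin (m + 1)} (h1 : x ≠ i.castSucc) (h2 : x ≠ i.succ) :
    adj i x = x :=
  Equiv.swap_apply_of_ne_of_ne h1 h2

theorem mul_adj_symm_apply (σ : Equiv.Perm (Fin (m + 1))) (i : Fin m) (a : Fin (m + 1)) :
    (σ * adj i).symm a = adj i (σ.symm a) := by
  rw [Equiv.symm_apply_eq]
  simp

theorem adj_lt_adj_iff {i : Fin m} {x y : Fin (m + 1)}
    (h1 : ¬ (x = i.castSucc ∧ y = i.succ)) (h2 : ¬ (x = i.succ ∧ y = i.castSucc)) :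
    adj i x < adj i y ↔ x < y := by
  simp only [adj, Equiv.swap_apply_def, Fin.ext_iff, Fin.lt_def, Fin.val_castSucc,
    Fin.val_succ] at *
  split_ifs <;> simp only [Fin.val_castSucc, Fin.val_succ] <;> omega

theorem permWeight_pos {n : ℕ} {q : Fin n → Fin n → ℝ} (hq : ∀ u v, u < v → 0 < q u v)
    (σ : Equiv.Perm (Fin n)) : 0 < permWeight q σ := by
  refine Finset.prod_pos fun u _ => Finset.prod_pos fun v _ => ?_
  split_ifs with h
  · exact hq _ _ h.1
  · exact one_pos

theorem permWeight_of_descent (q : Fin (m + 1) → Fin (m + 1) → ℝ)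
    (σ : Equiv.Perm (Fin (m + 1))) {i : Fin m} (h : σ i.succ < σ i.castSucc) :
    permWeight q σ = q (σ i.succ) (σ i.castSucc) * permWeight q (σ * adj i) := by
  have hlt : i.castSucc < i.succ := Fin.castSucc_lt_succ
  rw [permWeight, permWeight, ← Fintype.prod_prod_type', ← Fintype.prod_prod_type',
    ← Finset.mul_prod_erase univ _ (Finset.mem_univ (σ i.succ, σ i.castSucc)),
    ← Finset.mul_prod_erase univ (fun x : Fin (m + 1) × Fin (m + 1) =>
      if x.1 < x.2 ∧ (σ * adj i).symm x.2 < (σ * adj i).symm x.1 then q x.1 x.2 else 1)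
      (Finset.mem_univ (σ i.succ, σ i.castSucc))]
  congr 1
  · simp [h, hlt]
  · simp only [mul_adj_symm_apply, Equiv.symm_apply_apply, adj_castSucc, adj_succ]
    rw [if_neg (fun hc => lt_asymm hlt hc.2), one_mul]
    refine Finset.prod_congr rfl fun z hz => ?_
    have hz' : z ≠ (σ i.succ, σ i.castSucc) := Finset.ne_of_mem_erase hz
    by_cases h1 : z.1 < z.2
    · have hiff : adj i (σ.symm z.2) < adj i (σ.symm z.1) ↔ σ.symm z.2 < σ.symm z.1 := by
        apply adj_lt_adj_iff
        · rintro ⟨e1, e2⟩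
          rw [Equiv.symm_apply_eq] at e1 e2
          exact hz' (Prod.ext e2 e1)
        · rintro ⟨e1, e2⟩
          rw [Equiv.symm_apply_eq] at e1 e2
          rw [e1, e2] at h1
          exact lt_asymm h h1
      simp only [hiff]
    · simp [h1]

/-- Position `i` holds a label `≥ t` and position `i + 1` a label `< t`. -/
def IsDesc (t : ℕ) (σ : Equiv.Perm (Fin (m + 1))) (i : Fin m) : Prop :=
  t ≤ (σ i.castSucc : ℕ) ∧ (σ i.succ : ℕ) < t

theorem exists_first_desc {t : ℕ} {σ : Equiv.Perm (Fin (m + 1))} (h : ∃ i, IsDesc t σ i) :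
    ∃ i, IsDesc t σ i ∧ ∀ j, j < i → ¬ IsDesc t σ j := by
  obtain ⟨i, hi, hmin⟩ := WellFounded.has_min (wellFounded_lt (α := Fin m)) {i | IsDesc t σ i} h
  exact ⟨i, hi, fun j hj hc => hmin j hc hj⟩

open Classical in
/-- Swap the first adjacent pair that is out of order with respect to the threshold `t`. -/
noncomputable def sortStep (t : ℕ) (σ : Equiv.Perm (Fin (m + 1))) : Equiv.Perm (Fin (m + 1)) :=
  if h : ∃ i, IsDesc t σ i then σ * adj (exists_first_desc h).choose else σ

theorem sortStep_of_not {t : ℕ} {σ : Equiv.Perm (Fin (m + 1))} (h : ¬ ∃ i, IsDesc t σ i) :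
    sortStep t σ = σ :=
  dif_neg h

theorem sortStep_eq {t : ℕ} {σ : Equiv.Perm (Fin (m + 1))} (h : ∃ i, IsDesc t σ i) :
    ∃ i, IsDesc t σ i ∧ (∀ j, j < i → ¬ IsDesc t σ j) ∧ sortStep t σ = σ * adj i :=
  ⟨_, (exists_first_desc h).choose_spec.1, (exists_first_desc h).choose_spec.2, dif_pos h⟩

theorem threshold_mono {t : ℕ} {σ : Equiv.Perm (Fin (m + 1))} {N : ℕ}
    (h : ∀ j : Fin m, (j : ℕ) < N → ¬ IsDesc t σ j) {a b : Fin (m + 1)} (hab : a ≤ b)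
    (hb : (b : ℕ) ≤ N) (ha : t ≤ (σ a : ℕ)) : t ≤ (σ b : ℕ) := by
  induction b using Fin.induction with
  | zero =>
    have : a = 0 := le_antisymm hab (Fin.zero_le _)
    rwa [← this]
  | succ j ih =>
    rcases hab.lt_or_eq with hlt | heq
    · have h1 : t ≤ (σ j.castSucc : ℕ) := by
        refine ih (Fin.le_castSucc_iff.2 hlt) ?_
        simp only [Fin.val_succ, Fin.val_castSucc] at hb ⊢
        omega
      by_contra hc
      exact h j (by simp only [Fin.val_succ] at hb; omega) ⟨h1, not_le.1 hc⟩
    · rwa [← heq]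

theorem sortStep_lt_iff {t : ℕ} (σ : Equiv.Perm (Fin (m + 1))) {x y : Fin (m + 1)}
    (hxy : t ≤ (x : ℕ) ↔ t ≤ (y : ℕ)) :
    (sortStep t σ).symm x < (sortStep t σ).symm y ↔ σ.symm x < σ.symm y := by
  by_cases h : ∃ i, IsDesc t σ i
  · obtain ⟨i, hi, -, he⟩ := sortStep_eq h
    rw [he, mul_adj_symm_apply, mul_adj_symm_apply]
    apply adj_lt_adj_iff
    all_goals
      rintro ⟨e1, e2⟩
      rw [Equiv.symm_apply_eq] at e1 e2
      have h1 := hi.1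
      have h2 := hi.2
      rw [e1, e2] at hxy
      omega
  · rw [sortStep_of_not h]

theorem iterate_sortStep_lt_iff {t : ℕ} (k : ℕ) (σ : Equiv.Perm (Fin (m + 1)))
    {x y : Fin (m + 1)} (hxy : t ≤ (x : ℕ) ↔ t ≤ (y : ℕ)) :
    ((sortStep t)^[k] σ).symm x < ((sortStep t)^[k] σ).symm y ↔ σ.symm x < σ.symm y := by
  induction k with
  | zero => rfl
  | succ k ih => rw [Function.iterate_succ_apply', sortStep_lt_iff _ hxy, ih]

/-- The inversions of `σ` between labels on different sides of the threshold `t`. -/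
def thresholdInv (t : ℕ) (σ : Equiv.Perm (Fin (m + 1))) : Finset (Fin (m + 1) × Fin (m + 1)) :=
  univ.filter fun z => (z.1 : ℕ) < t ∧ t ≤ (z.2 : ℕ) ∧ σ.symm z.2 < σ.symm z.1

theorem thresholdInv_sortStep {t : ℕ} {σ : Equiv.Perm (Fin (m + 1))} (h : ∃ i, IsDesc t σ i) :
    (thresholdInv t (sortStep t σ)).card < (thresholdInv t σ).card := by
  obtain ⟨i, hi, -, he⟩ := sortStep_eq h
  have hlt : i.castSucc < i.succ := Fin.castSucc_lt_succ
  apply Finset.card_lt_card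
  refine (Finset.ssubset_iff_of_subset ?_).2 ⟨(σ i.succ, σ i.castSucc), ?_, ?_⟩
  · intro z hz
    simp only [thresholdInv, Finset.mem_filter, Finset.mem_univ, true_and, he,
      mul_adj_symm_apply] at hz ⊢
    refine ⟨hz.1, hz.2.1, ?_⟩
    by_cases h1 : σ.symm z.2 = i.castSucc ∧ σ.symm z.1 = i.succ
    · rw [h1.1, h1.2]
      exact hlt
    · refine (adj_lt_adj_iff h1 ?_).1 hz.2.2
      rintro ⟨e1, e2⟩
      rw [Equiv.symm_apply_eq] at e1 e2
      have h2 := hi.2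
      rw [← e1] at h2
      omega
  · simp [thresholdInv, hi.1, hi.2]
  · simp only [thresholdInv, Finset.mem_filter, Finset.mem_univ, true_and, he,
      mul_adj_symm_apply, Equiv.symm_apply_apply, adj_castSucc, adj_succ]
    rintro ⟨-, -, h3⟩
    exact lt_asymm hlt h3

theorem iterate_sortStep_sorted {t : ℕ} (k : ℕ) (σ : Equiv.Perm (Fin (m + 1)))
    (hk : (thresholdInv t σ).card ≤ k) : ¬ ∃ i, IsDesc t ((sortStep t)^[k] σ) i := by
  induction k generalizing σ with
  | zero =>
    intro h
    have := thresholdInv_sortStep h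
    simp only [Function.iterate_zero, id] at this
    omega
  | succ k ih =>
    rw [Function.iterate_succ_apply]
    apply ih
    by_cases h : ∃ i, IsDesc t σ i
    · have := thresholdInv_sortStep h
      omega
    · have h0 : thresholdInv t σ = ∅ := by
        rw [thresholdInv, Finset.filter_eq_empty_iff]
        rintro z - ⟨h1, h2, h3⟩
        have := threshold_mono (N := m) (fun j _ => not_exists.1 h j) h3.le
          (Nat.lt_succ_iff.1 (Fin.is_lt _)) (by simpa using h2)
        simp only [Equiv.apply_symm_apply] at this
        omega
      rw [sortStep_of_not h, h0]
      simp

/-- Stably sort a permutation so that all labels `< t` precede all labels `≥ t`. -/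
noncomputable def thresholdSort (t : ℕ) (σ : Equiv.Perm (Fin (m + 1))) :
    Equiv.Perm (Fin (m + 1)) :=
  (sortStep t)^[(m + 1) * (m + 1)] σ

theorem not_isDesc_thresholdSort (t : ℕ) (σ : Equiv.Perm (Fin (m + 1))) :
    ¬ ∃ i, IsDesc t (thresholdSort t σ) i := by
  apply iterate_sortStep_sorted
  refine (Finset.card_le_univ _).trans ?_
  simp

theorem thresholdSort_lt_iff {t : ℕ} (σ : Equiv.Perm (Fin (m + 1)))
    {x y : Fin (m + 1)} (hxy : t ≤ (x : ℕ) ↔ t ≤ (y : ℕ)) :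
    (thresholdSort t σ).symm x < (thresholdSort t σ).symm y ↔ σ.symm x < σ.symm y :=
  iterate_sortStep_lt_iff _ σ hxy

theorem thresholdSort_lt {t : ℕ} (σ : Equiv.Perm (Fin (m + 1)))
    {x y : Fin (m + 1)} (hx : (x : ℕ) < t) (hy : t ≤ (y : ℕ)) :
    (thresholdSort t σ).symm x < (thresholdSort t σ).symm y := by
  by_contra hc
  have := threshold_mono (N := m) (fun j _ => not_exists.1 (not_isDesc_thresholdSort t σ) j)
    (not_lt.1 hc) (Nat.lt_succ_iff.1 (Fin.is_lt _)) (by simpa using hy)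
  simp only [Equiv.apply_symm_apply] at this
  omega

theorem first_desc_unique {t : ℕ} {σ σ' : Equiv.Perm (Fin (m + 1))} {i i' : Fin m}
    (hi : IsDesc t σ i) (hi' : IsDesc t σ' i')
    (hmin' : ∀ j, j < i' → ¬ IsDesc t σ' j) (he : σ * adj i = σ' * adj i')
    (hflag : (∃ j : Fin m, j.succ = i'.castSucc ∧ t ≤ (σ' j.castSucc : ℕ)) →
      ∃ j : Fin m, j.succ = i.castSucc ∧ t ≤ (σ j.castSucc : ℕ)) : ¬ i < i' := by
  intro hlt
  have hz : ∀ x, (σ * adj i) x = (σ' * adj i') x := fun x => by rw [he]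
  have hbelow : ∀ x : Fin (m + 1), x < i'.castSucc → (σ' x) = σ (adj i x) := fun x hx => by
    have := hz x
    rw [Equiv.Perm.mul_apply, Equiv.Perm.mul_apply, adj_of_ne hx.ne] at this
    · exact this.symm
    · exact (hx.trans Fin.castSucc_lt_succ).ne
  have h1 : i.succ ≠ i'.castSucc := by
    intro hc
    have := hz i'.castSucc
    rw [← hc, Equiv.Perm.mul_apply, Equiv.Perm.mul_apply, adj_succ, hc, adj_castSucc] at this
    have h2 := hi.1
    have h3 := hi'.2
    rw [this] at h2
    omega
  have h2 : i.succ < i'.castSucc := by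
    rw [Fin.lt_def, Fin.val_succ, Fin.val_castSucc]
    rw [Ne, Fin.ext_iff, Fin.val_succ, Fin.val_castSucc] at h1
    rw [Fin.lt_def] at hlt
    omega
  have h3 : t ≤ (σ' i.succ : ℕ) := by
    rw [hbelow _ h2, adj_succ]
    exact hi.1
  have hval : (i : ℕ) + 1 < i' := by
    rw [Fin.lt_def, Fin.val_succ, Fin.val_castSucc] at h2
    exact h2
  obtain ⟨j, hj, hj2⟩ := hflag ⟨⟨i' - 1, by omega⟩, by
      ext; simp only [Fin.val_succ, Fin.val_castSucc]; omega, by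
      refine threshold_mono (N := i') (fun j hj => hmin' j hj) ?_ ?_ h3
      · rw [Fin.le_def]; simp only [Fin.val_succ, Fin.val_castSucc]; omega
      · simp only [Fin.val_castSucc]; omega⟩
  have hjv : (j : ℕ) + 1 = i := by
    have := congrArg Fin.val hj
    simpa using this
  have hc1 : j.castSucc < i'.castSucc := by
    rw [Fin.lt_def, Fin.val_castSucc, Fin.val_castSucc]; omega
  have hc2 : i.castSucc < i'.castSucc := hlt
  refine hmin' j (by rw [Fin.lt_def]; omega) ⟨?_, ?_⟩
  · rw [hbelow _ hc1, adj_of_ne]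
    · exact hj2
    · rw [Ne, Fin.ext_iff, Fin.val_castSucc, Fin.val_castSucc]; omega
    · rw [Ne, Fin.ext_iff, Fin.val_castSucc, Fin.val_succ]; omega
  · rw [hj, hbelow _ hc2, adj_castSucc]
    exact hi.2

open Classical in
theorem sum_sortStep_le {q : Fin (m + 1) → Fin (m + 1) → ℝ} {qb : ℝ}
    (hq0 : ∀ u v, u < v → 0 < q u v) (hq : ∀ u v, u < v → q u v ≤ qb) (hqb : 0 ≤ qb) (t : ℕ)
    (φ : Equiv.Perm (Fin (m + 1)) → ℝ) (hφ : ∀ σ, 0 ≤ φ σ) :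
    ∑ σ, (if ∃ i, IsDesc t σ i then permWeight q σ * φ (sortStep t σ) else 0) ≤
      (2 * qb) * ∑ σ, permWeight q σ * φ σ := by
  have hle : ∀ σ : Equiv.Perm (Fin (m + 1)), (∃ i, IsDesc t σ i) →
      permWeight q σ ≤ qb * permWeight q (sortStep t σ) := by
    intro σ h
    obtain ⟨i, hi, -, he⟩ := sortStep_eq h
    have hd : σ i.succ < σ i.castSucc := by
      rw [Fin.lt_def]; exact lt_of_lt_of_le hi.2 hi.1
    rw [permWeight_of_descent q σ hd, he]
    exact mul_le_mul_of_nonneg_right (hq _ _ hd) (permWeight_pos hq0 _).le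
  let flag : Equiv.Perm (Fin (m + 1)) → Prop := fun σ =>
    ∃ i, IsDesc t σ i ∧ (∀ j, j < i → ¬ IsDesc t σ j) ∧
      ∃ j : Fin m, j.succ = i.castSucc ∧ t ≤ (σ j.castSucc : ℕ)
  have hflag : ∀ σ i, IsDesc t σ i → (∀ j, j < i → ¬ IsDesc t σ j) →
      (flag σ ↔ ∃ j : Fin m, j.succ = i.castSucc ∧ t ≤ (σ j.castSucc : ℕ)) := by
    intro σ i h1 h2
    constructor
    · rintro ⟨i', h1', h2', h3⟩
      have : i = i' := le_antisymm (not_lt.1 fun hc => h2 _ hc h1')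
        (not_lt.1 fun hc => h2' _ hc h1)
      rwa [this]
    · exact fun h => ⟨i, h1, h2, h⟩
  have hinj : ∀ σ σ' : Equiv.Perm (Fin (m + 1)), (∃ i, IsDesc t σ i) → (∃ i, IsDesc t σ' i) →
      (flag σ ↔ flag σ') → sortStep t σ = sortStep t σ' → σ = σ' := by
    intro σ σ' h h' hf he
    obtain ⟨i, hi, hmin, hs⟩ := sortStep_eq h
    obtain ⟨i', hi', hmin', hs'⟩ := sortStep_eq h'
    rw [hflag σ i hi hmin, hflag σ' i' hi' hmin'] at hf
    rw [hs, hs'] at he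
    have : i = i' := le_antisymm
      (not_lt.1 (first_desc_unique hi' hi hmin he.symm hf.1))
      (not_lt.1 (first_desc_unique hi hi' hmin' he hf.2))
    subst this
    exact mul_right_cancel he
  have hpart : ∀ P : Equiv.Perm (Fin (m + 1)) → Prop,
      (∀ σ σ', P σ → P σ' → (flag σ ↔ flag σ')) →
      ∑ σ ∈ univ.filter (fun σ => (∃ i, IsDesc t σ i) ∧ P σ),
        permWeight q σ * φ (sortStep t σ) ≤ qb * ∑ σ, permWeight q σ * φ σ := by
    intro P hP
    have hinjOn : Set.InjOn (sortStep t)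
        ((univ.filter (fun σ : Equiv.Perm (Fin (m + 1)) => (∃ i, IsDesc t σ i) ∧ P σ) :
          Finset (Equiv.Perm (Fin (m + 1)))) : Set (Equiv.Perm (Fin (m + 1)))) := by
      intro σ h σ' h' he
      simp only [Finset.coe_filter, Finset.mem_univ, true_and, Set.mem_ofPred_eq] at h h'
      exact hinj _ _ h.1 h'.1 (hP _ _ h.2 h'.2) he
    calc ∑ σ ∈ univ.filter (fun σ => (∃ i, IsDesc t σ i) ∧ P σ),
          permWeight q σ * φ (sortStep t σ)
        ≤ ∑ σ ∈ univ.filter (fun σ => (∃ i, IsDesc t σ i) ∧ P σ),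
          qb * (permWeight q (sortStep t σ) * φ (sortStep t σ)) := by
          refine Finset.sum_le_sum fun σ hσ => ?_
          rw [← mul_assoc]
          exact mul_le_mul_of_nonneg_right (hle σ (Finset.mem_filter.1 hσ).2.1) (hφ _)
      _ = qb * ∑ τ ∈ (univ.filter (fun σ => (∃ i, IsDesc t σ i) ∧ P σ)).image (sortStep t),
          permWeight q τ * φ τ := by
          rw [← Finset.mul_sum, Finset.sum_image hinjOn]
      _ ≤ qb * ∑ σ, permWeight q σ * φ σ := by
          refine mul_le_mul_of_nonneg_left ?_ hqb
          exact Finset.sum_le_sum_of_subset_of_nonneg (Finset.subset_univ _)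
            fun σ _ _ => mul_nonneg (permWeight_pos hq0 _).le (hφ _)
  rw [← Finset.sum_filter, ← Finset.sum_filter_add_sum_filter_not _ flag, Finset.filter_filter,
    Finset.filter_filter]
  have h1 := hpart flag fun σ σ' h h' => iff_of_true h h'
  have h2 := hpart (fun σ => ¬ flag σ) fun σ σ' h h' => iff_of_false h h'
  refine (add_le_add (le_trans (le_of_eq ?_) h1) (le_trans (le_of_eq ?_) h2)).trans
    (le_of_eq (by ring))
  all_goals
    refine Finset.sum_congr ?_ fun _ _ => rfl
    ext σ
    simp

/-- The part of the Dirichlet form coming from moves that resolve a descent. -/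
noncomputable def descentForm (q : Fin (m + 1) → Fin (m + 1) → ℝ)
    (f : Equiv.Perm (Fin (m + 1)) → ℝ) : ℝ :=
  ∑ σ : Equiv.Perm (Fin (m + 1)), ∑ i : Fin m,
    if σ i.succ < σ i.castSucc then permWeight q σ * (f σ - f (σ * adj i)) ^ 2 else 0

theorem sum_comp_thresholdSort_le {q : Fin (m + 1) → Fin (m + 1) → ℝ} {qb : ℝ}
    (hq0 : ∀ u v, u < v → 0 < q u v) (hq : ∀ u v, u < v → q u v ≤ qb) (hqb : 0 ≤ qb)
    (hqb2 : qb < 1 / 2) (t : ℕ) {h : Equiv.Perm (Fin (m + 1)) → ℝ} (hh : ∀ σ, 0 ≤ h σ) :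
    ∑ σ, permWeight q σ * h (thresholdSort t σ) ≤
      (1 / (1 - 2 * qb)) * ∑ σ, permWeight q σ * h σ := by
  classical
  exact sum_iterate_le (fun σ => (permWeight_pos hq0 σ).le) (by linarith)
    (fun σ h => sortStep_of_not h) (sum_sortStep_le hq0 hq hqb t)
    (not_isDesc_thresholdSort t) hh

theorem sum_sub_thresholdSort_le {q : Fin (m + 1) → Fin (m + 1) → ℝ} {qb : ℝ}
    (hq0 : ∀ u v, u < v → 0 < q u v) (hq : ∀ u v, u < v → q u v ≤ qb) (hqb : 0 ≤ qb)
    (hqb2 : qb < 1 / 2) (t : ℕ) (f : Equiv.Perm (Fin (m + 1)) → ℝ) :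
    ∑ σ, permWeight q σ * (f σ - f (thresholdSort t σ)) ^ 2 ≤
      ((1 + 2 / (1 - 2 * qb)) * (2 / (1 - 2 * qb))) * descentForm q f := by
  classical
  refine (sum_sub_iterate_sq_le (fun σ => (permWeight_pos hq0 σ).le) (by linarith)
    (fun σ h => sortStep_of_not h) (sum_sortStep_le hq0 hq hqb t)
    (not_isDesc_thresholdSort t) f).trans ?_
  have h0 : 0 < 1 - 2 * qb := by linarith
  refine mul_le_mul_of_nonneg_left ?_ (by positivity)
  refine Finset.sum_le_sum fun σ _ => ?_
  have hnn : ∀ i : Fin m, 0 ≤ (if σ i.succ < σ i.castSucc then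
      permWeight q σ * (f σ - f (σ * adj i)) ^ 2 else 0) := fun i => by
    have := (permWeight_pos hq0 σ).le
    split_ifs <;> positivity
  split_ifs with h
  · obtain ⟨i, hi, -, he⟩ := sortStep_eq h
    have hd : σ i.succ < σ i.castSucc := by
      rw [Fin.lt_def]; exact lt_of_lt_of_le hi.2 hi.1
    refine le_trans ?_ (Finset.single_le_sum (fun i _ => hnn i) (Finset.mem_univ i))
    rw [if_pos hd, he]
  · exact Finset.sum_nonneg fun i _ => hnn i

end Sorting

section Poincare

theorem sum_sq_sub_le {ι : Type*} [Fintype ι] {w x y : ι → ℝ} (hw : ∀ i, 0 ≤ w i) {a b ε : ℝ}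
    (ha : 0 < a) (hb : 0 < b) (hx : ∑ i, w i * x i ^ 2 ≤ a ^ 2 * ε)
    (hy : ∑ i, w i * y i ^ 2 ≤ b ^ 2 * ε) :
    ∑ i, w i * (x i - y i) ^ 2 ≤ (a + b) ^ 2 * ε := by
  have key : ∀ i, w i * (x i - y i) ^ 2 ≤
      (1 + b / a) * (w i * x i ^ 2) + (1 + a / b) * (w i * y i ^ 2) := fun i => by
    have h : (1 + b / a) * x i ^ 2 + (1 + a / b) * y i ^ 2 - (x i - y i) ^ 2 =
        (1 / (a * b)) * (b * x i + a * y i) ^ 2 := by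
      field_simp
      ring
    have h0 : 0 ≤ (1 / (a * b)) * (b * x i + a * y i) ^ 2 := by positivity
    nlinarith [mul_nonneg (hw i) (h0.trans h.ge)]
  calc ∑ i, w i * (x i - y i) ^ 2
      ≤ (1 + b / a) * ∑ i, w i * x i ^ 2 + (1 + a / b) * ∑ i, w i * y i ^ 2 := by
        rw [Finset.mul_sum, Finset.mul_sum, ← Finset.sum_add_distrib]
        exact Finset.sum_le_sum fun i _ => key i
    _ ≤ (1 + b / a) * (a ^ 2 * ε) + (1 + a / b) * (b ^ 2 * ε) := by gcongr
    _ = (a + b) ^ 2 * ε := by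
        field_simp
        ring

variable {m : ℕ}

/-- Sort successively with respect to each threshold of a list. -/
noncomputable def sortAll : List ℕ → Equiv.Perm (Fin (m + 1)) → Equiv.Perm (Fin (m + 1))
  | [], σ => σ
  | t :: l, σ => sortAll l (thresholdSort t σ)

theorem sortAll_congr (l : List ℕ) {σ τ : Equiv.Perm (Fin (m + 1))}
    (h : ∀ x y : Fin (m + 1), (∀ t ∈ l, (t ≤ (x : ℕ) ↔ t ≤ (y : ℕ))) →
      (σ.symm x < σ.symm y ↔ τ.symm x < τ.symm y)) : sortAll l σ = sortAll l τ := by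
  induction l generalizing σ τ with
  | nil =>
    exact perm_eq_of_agree (V := univ) (fun a ha => absurd (Finset.mem_univ a) ha)
      fun a _ b _ => (h a b (by simp)).1
  | cons t l ih =>
    refine ih fun x y hxy => ?_
    by_cases hx : t ≤ (x : ℕ) <;> by_cases hy : t ≤ (y : ℕ)
    · rw [thresholdSort_lt_iff _ (iff_of_true hx hy), thresholdSort_lt_iff _ (iff_of_true hx hy)]
      exact h x y (by simpa [hx, hy] using hxy)
    · exact iff_of_false (thresholdSort_lt σ (not_le.1 hy) hx).not_gt
        (thresholdSort_lt τ (not_le.1 hy) hx).not_gt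
    · exact iff_of_true (thresholdSort_lt σ (not_le.1 hx) hy)
        (thresholdSort_lt τ (not_le.1 hx) hy)
    · rw [thresholdSort_lt_iff _ (iff_of_false hx hy), thresholdSort_lt_iff _ (iff_of_false hx hy)]
      exact h x y (by simpa [hx, hy] using hxy)

/-- The constant in the comparison of `f` and `f ∘ sortAll l` for lists of length `k`. -/
noncomputable def sortConst (qb : ℝ) : ℕ → ℝ
  | 0 => 0
  | k + 1 => 2 * ((1 + 2 / (1 - 2 * qb)) * (2 / (1 - 2 * qb))) +
      2 * (1 / (1 - 2 * qb) * sortConst qb k)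

theorem sum_sub_sortAll_le {q : Fin (m + 1) → Fin (m + 1) → ℝ} {qb : ℝ}
    (hq0 : ∀ u v, u < v → 0 < q u v) (hq : ∀ u v, u < v → q u v ≤ qb) (hqb : 0 ≤ qb)
    (hqb2 : qb < 1 / 2) (l : List ℕ) (f : Equiv.Perm (Fin (m + 1)) → ℝ) :
    ∑ σ, permWeight q σ * (f σ - f (sortAll l σ)) ^ 2 ≤
      sortConst qb l.length * descentForm q f := by
  induction l with
  | nil => simp [sortAll, sortConst]
  | cons t l ih =>
    have h1 := sum_sub_thresholdSort_le hq0 hq hqb hqb2 t f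
    have h2 := sum_comp_thresholdSort_le hq0 hq hqb hqb2 t
      (h := fun σ => (f σ - f (sortAll l σ)) ^ 2) fun σ => sq_nonneg _
    have h0 : 0 ≤ 1 / (1 - 2 * qb) := by
      have : 0 < 1 - 2 * qb := by linarith
      positivity
    have h3 := h2.trans (mul_le_mul_of_nonneg_left ih h0)
    have h4 : ∑ σ, permWeight q σ * (f σ - f (sortAll (t :: l) σ)) ^ 2 ≤
        2 * ∑ σ, permWeight q σ * (f σ - f (thresholdSort t σ)) ^ 2 +
        2 * ∑ σ, permWeight q σ *
          (f (thresholdSort t σ) - f (sortAll l (thresholdSort t σ))) ^ 2 := by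
      rw [Finset.mul_sum, Finset.mul_sum, ← Finset.sum_add_distrib]
      refine Finset.sum_le_sum fun σ _ => ?_
      rw [sortAll]
      have := (permWeight_pos hq0 σ).le
      have h5 := mul_nonneg this (sq_nonneg ((f σ - f (thresholdSort t σ)) -
        (f (thresholdSort t σ) - f (sortAll l (thresholdSort t σ)))))
      nlinarith
    rw [List.length_cons, sortConst]
    linarith

/-- The labels `a, a + 1, …, a + s - 1`. -/
def seg {n : ℕ} (a s : ℕ) : Finset (Fin n) :=
  univ.filter fun x => a ≤ (x : ℕ) ∧ (x : ℕ) < a + s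

@[simp] theorem mem_seg {n a s : ℕ} {x : Fin n} : x ∈ seg a s ↔ a ≤ (x : ℕ) ∧ (x : ℕ) < a + s := by
  simp [seg]

/-- Every subtree of `T`, with leaves labeled from `a` on, carries a module of labels. -/
def ModularAt {n : ℕ} (q : Fin n → Fin n → ℝ) : ℕ → STree → Prop
  | a, .leaf => IsModule q (seg a 1)
  | a, .node _ _ _ l c r =>
    IsModule q (seg a (l.numLeaves + c.numLeaves + r.numLeaves)) ∧ ModularAt q a l ∧
      ModularAt q (a + l.numLeaves) c ∧ ModularAt q (a + l.numLeaves + c.numLeaves) r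

theorem ModularAt.isModule {n : ℕ} {q : Fin n → Fin n → ℝ} {a : ℕ} {T : STree}
    (h : ModularAt q a T) : IsModule q (seg a T.numLeaves) := by
  cases T with
  | leaf => exact h
  | node => exact h.1

theorem STree.numLeaves_pos (T : STree) : 0 < T.numLeaves := by
  induction T with
  | leaf => exact one_pos
  | node _ _ _ l c r hl _ _ => simp only [STree.numLeaves]; omega

/-- Mean square change of `f` under the exchange of the relative orders of `V` in two
independent permutations. -/
noncomputable def exchangeForm {n : ℕ} (q : Fin n → Fin n → ℝ) (V : Finset (Fin n))
    (f : Equiv.Perm (Fin n) → ℝ) : ℝ :=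
  ∑ p : Equiv.Perm (Fin n) × Equiv.Perm (Fin n),
    permWeight q p.1 * permWeight q p.2 * (f p.1 - f (exchange V p).1) ^ 2

theorem sum_pair_fst {n : ℕ} (q : Fin n → Fin n → ℝ) (h : Equiv.Perm (Fin n) → ℝ) :
    ∑ p : Equiv.Perm (Fin n) × Equiv.Perm (Fin n), permWeight q p.1 * permWeight q p.2 * h p.1 =
      (∑ σ, permWeight q σ) * ∑ σ, permWeight q σ * h σ := by
  rw [Fintype.sum_prod_type, mul_comm, Finset.sum_mul_sum]
  exact Finset.sum_congr rfl fun σ _ => Finset.sum_congr rfl fun τ _ => by ring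

theorem exchange_singleton {n : ℕ} {V : Finset (Fin n)} (hV : ∀ x ∈ V, ∀ y ∈ V, x = y)
    (p : Equiv.Perm (Fin n) × Equiv.Perm (Fin n)) : (exchange V p).1 = p.1 := by
  apply perm_eq_of_agree (V := V)
  · exact fun a ha => reorder_symm_of_notMem _ _ ha
  · intro a ha b hb hlt
    rw [hV a ha b hb] at hlt
    exact absurd hlt (lt_irrefl _)

theorem sortAll_exchange (p : Equiv.Perm (Fin (m + 1)) × Equiv.Perm (Fin (m + 1)))
    (a l c r : ℕ) :
    sortAll [a, a + l, a + l + c, a + l + c + r]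
      (exchange (seg (a + l + c) r) (exchange (seg (a + l) c) (exchange (seg a l)
        (exchange (seg a (l + c + r)) p)))).1 =
    sortAll [a, a + l, a + l + c, a + l + c + r] p.1 := by
  apply sortAll_congr
  intro x y h
  simp only [List.mem_cons, List.not_mem_nil, or_false, forall_eq_or_imp, forall_eq] at h
  obtain ⟨h1, h2, h3, h4⟩ := h
  simp only [exchange]
  rcases lt_or_ge (x : ℕ) a with hx | hx
  · have e : ∀ z : Fin (m + 1), (z : ℕ) < a → (reorder (seg (a + l + c) r)
        (reorder (seg (a + l) c) (reorder (seg a l) (reorder (seg a (l + c + r)) p.1 p.2)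
          (reorder (seg a (l + c + r)) p.2 p.1)) (reorder (seg a l)
          (reorder (seg a (l + c + r)) p.2 p.1) (reorder (seg a (l + c + r)) p.1 p.2)))
        (reorder (seg (a + l) c) (reorder (seg a l) (reorder (seg a (l + c + r)) p.2 p.1)
          (reorder (seg a (l + c + r)) p.1 p.2)) (reorder (seg a l)
          (reorder (seg a (l + c + r)) p.1 p.2) (reorder (seg a (l + c + r)) p.2 p.1)))).symm z =
        p.1.symm z := fun z hz => by
      repeat rw [reorder_symm_of_notMem _ _ (by rw [mem_seg]; omega)]
    rw [e x hx, e y (by omega)]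
  rcases lt_or_ge (x : ℕ) (a + l) with hx2 | hx2
  · have hL : ∀ z ∈ [x, y], a ≤ (z : ℕ) ∧ (z : ℕ) < a + l := by
      simp only [List.mem_cons, List.not_mem_nil, or_false, forall_eq_or_imp, forall_eq]
      omega
    have hx' := hL x (by simp)
    have hy' := hL y (by simp)
    rw [reorder_symm_of_notMem _ _ (a := x) (by rw [mem_seg]; omega),
      reorder_symm_of_notMem _ _ (a := y) (by rw [mem_seg]; omega),
      reorder_symm_of_notMem _ _ (a := x) (by rw [mem_seg]; omega),
      reorder_symm_of_notMem _ _ (a := y) (by rw [mem_seg]; omega),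
      reorder_lt_iff _ _ (by rw [mem_seg]; omega) (by rw [mem_seg]; omega),
      reorder_lt_iff _ _ (by rw [mem_seg]; omega) (by rw [mem_seg]; omega)]
  rcases lt_or_ge (x : ℕ) (a + l + c) with hx3 | hx3
  · have hy' : a + l ≤ (y : ℕ) ∧ (y : ℕ) < a + l + c := by omega
    rw [reorder_symm_of_notMem _ _ (a := x) (by rw [mem_seg]; omega),
      reorder_symm_of_notMem _ _ (a := y) (by rw [mem_seg]; omega),
      reorder_lt_iff _ _ (by rw [mem_seg]; omega) (by rw [mem_seg]; omega),
      reorder_symm_of_notMem _ _ (a := x) (by rw [mem_seg]; omega),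
      reorder_symm_of_notMem _ _ (a := y) (by rw [mem_seg]; omega),
      reorder_lt_iff _ _ (by rw [mem_seg]; omega) (by rw [mem_seg]; omega)]
  rcases lt_or_ge (x : ℕ) (a + l + c + r) with hx4 | hx4
  · have hy' : a + l + c ≤ (y : ℕ) ∧ (y : ℕ) < a + l + c + r := by omega
    rw [reorder_lt_iff _ _ (by rw [mem_seg]; omega) (by rw [mem_seg]; omega),
      reorder_symm_of_notMem _ _ (a := x) (by rw [mem_seg]; omega),
      reorder_symm_of_notMem _ _ (a := y) (by rw [mem_seg]; omega),
      reorder_symm_of_notMem _ _ (a := x) (by rw [mem_seg]; omega),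
      reorder_symm_of_notMem _ _ (a := y) (by rw [mem_seg]; omega),
      reorder_lt_iff _ _ (by rw [mem_seg]; omega) (by rw [mem_seg]; omega)]
  · have hy' : a + l + c + r ≤ (y : ℕ) := by omega
    rw [reorder_symm_of_notMem _ _ (a := x) (by rw [mem_seg]; omega),
      reorder_symm_of_notMem _ _ (a := y) (by rw [mem_seg]; omega),
      reorder_symm_of_notMem _ _ (a := x) (by rw [mem_seg]; omega),
      reorder_symm_of_notMem _ _ (a := y) (by rw [mem_seg]; omega),
      reorder_symm_of_notMem _ _ (a := x) (by rw [mem_seg]; omega),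
      reorder_symm_of_notMem _ _ (a := y) (by rw [mem_seg]; omega),
      reorder_symm_of_notMem _ _ (a := x) (by rw [mem_seg]; omega),
      reorder_symm_of_notMem _ _ (a := y) (by rw [mem_seg]; omega)]

theorem sum_sq_sub_le_of_sortAll_eq {q : Fin (m + 1) → Fin (m + 1) → ℝ} {qb : ℝ}
    (hq0 : ∀ u v, u < v → 0 < q u v) (hq : ∀ u v, u < v → q u v ≤ qb) (hqb : 0 ≤ qb)
    (hqb2 : qb < 1 / 2) (f : Equiv.Perm (Fin (m + 1)) → ℝ) (ts : List ℕ)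
    (Y : Equiv.Perm (Fin (m + 1)) × Equiv.Perm (Fin (m + 1)) →
      Equiv.Perm (Fin (m + 1)) × Equiv.Perm (Fin (m + 1)))
    (hY : ∀ F : Equiv.Perm (Fin (m + 1)) × Equiv.Perm (Fin (m + 1)) → ℝ,
      ∑ p : Equiv.Perm (Fin (m + 1)) × Equiv.Perm (Fin (m + 1)),
        permWeight q p.1 * permWeight q p.2 * F (Y p) =
      ∑ p : Equiv.Perm (Fin (m + 1)) × Equiv.Perm (Fin (m + 1)),
        permWeight q p.1 * permWeight q p.2 * F p)
    (hts : ∀ p, sortAll ts (Y p).1 = sortAll ts p.1) :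
    ∑ p : Equiv.Perm (Fin (m + 1)) × Equiv.Perm (Fin (m + 1)),
        permWeight q p.1 * permWeight q p.2 * (f p.1 - f (Y p).1) ^ 2 ≤
      4 * (∑ σ, permWeight q σ) * (sortConst qb ts.length * descentForm q f) := by
  have h1 := sum_pair_fst q fun σ => (f σ - f (sortAll ts σ)) ^ 2
  have h2 := (hY fun p => (f p.1 - f (sortAll ts p.1)) ^ 2).trans h1
  have hZ : 0 ≤ ∑ σ, permWeight q σ := Finset.sum_nonneg fun σ _ => (permWeight_pos hq0 σ).le
  have h3 := mul_le_mul_of_nonneg_left (sum_sub_sortAll_le hq0 hq hqb hqb2 ts f) hZ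
  have h4 : ∑ p : Equiv.Perm (Fin (m + 1)) × Equiv.Perm (Fin (m + 1)),
      permWeight q p.1 * permWeight q p.2 * (f p.1 - f (Y p).1) ^ 2 ≤
      2 * ∑ p : Equiv.Perm (Fin (m + 1)) × Equiv.Perm (Fin (m + 1)),
        permWeight q p.1 * permWeight q p.2 * (f p.1 - f (sortAll ts p.1)) ^ 2 +
      2 * ∑ p : Equiv.Perm (Fin (m + 1)) × Equiv.Perm (Fin (m + 1)),
        permWeight q p.1 * permWeight q p.2 * (f (Y p).1 - f (sortAll ts (Y p).1)) ^ 2 := by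
    rw [Finset.mul_sum, Finset.mul_sum, ← Finset.sum_add_distrib]
    refine Finset.sum_le_sum fun p _ => ?_
    rw [hts]
    have := (mul_pos (permWeight_pos hq0 p.1) (permWeight_pos hq0 p.2)).le
    have h5 := mul_nonneg this (sq_nonneg ((f p.1 - f (sortAll ts p.1)) +
      (f (Y p).1 - f (sortAll ts p.1))))
    nlinarith
  rw [h1, h2] at h4
  linarith

theorem exchangeForm_le {q : Fin (m + 1) → Fin (m + 1) → ℝ} {qb : ℝ}
    (hq0 : ∀ u v, u < v → 0 < q u v) (hq : ∀ u v, u < v → q u v ≤ qb) (hqb : 0 ≤ qb)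
    (hqb2 : qb < 1 / 2) (f : Equiv.Perm (Fin (m + 1)) → ℝ) (T : STree) (a : ℕ)
    (hT : ModularAt q a T) :
    exchangeForm q (seg a T.numLeaves) f ≤ (2 * (T.numLeaves : ℝ) - 1) ^ 2 *
      (4 * (∑ σ, permWeight q σ) * (sortConst qb 4 * descentForm q f)) := by
  have hε : 0 ≤ 4 * (∑ σ, permWeight q σ) * (sortConst qb 4 * descentForm q f) :=
    le_trans (Finset.sum_nonneg fun p _ => mul_nonneg
        (mul_pos (permWeight_pos hq0 p.1) (permWeight_pos hq0 p.2)).le (sq_nonneg _))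
      (sum_sq_sub_le_of_sortAll_eq hq0 hq hqb hqb2 f [0, 0, 0, 0] id (fun _ => rfl) fun _ => rfl)
  induction T generalizing a with
  | leaf =>
    have h0 : exchangeForm q (seg a STree.leaf.numLeaves) f = 0 := by
      refine Finset.sum_eq_zero fun p _ => ?_
      rw [exchange_singleton]
      · simp
      · intro x hx y hy
        simp only [STree.numLeaves, mem_seg] at hx hy
        ext
        omega
    rw [h0]
    positivity
  | node sL sC sR l c r ihl ihc ihr =>
    obtain ⟨hV, hl, hc, hr⟩ := hT
    have el := ihl a hl
    have ec := ihc _ hc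
    have er := ihr _ hr
    have hl1 : (1 : ℝ) ≤ l.numLeaves := by exact_mod_cast l.numLeaves_pos
    have hc1 : (1 : ℝ) ≤ c.numLeaves := by exact_mod_cast c.numLeaves_pos
    have hr1 : (1 : ℝ) ≤ r.numLeaves := by exact_mod_cast r.numLeaves_pos
    have hw : ∀ p : Equiv.Perm (Fin (m + 1)) × Equiv.Perm (Fin (m + 1)),
        0 ≤ permWeight q p.1 * permWeight q p.2 :=
      fun p => (mul_pos (permWeight_pos hq0 p.1) (permWeight_pos hq0 p.2)).le
    have e0 := sum_sq_sub_le_of_sortAll_eq hq0 hq hqb hqb2 f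
      [a, a + l.numLeaves, a + l.numLeaves + c.numLeaves,
        a + l.numLeaves + c.numLeaves + r.numLeaves]
      (fun p => exchange (seg (a + l.numLeaves + c.numLeaves) r.numLeaves)
        (exchange (seg (a + l.numLeaves) c.numLeaves) (exchange (seg a l.numLeaves)
        (exchange (seg a (l.numLeaves + c.numLeaves + r.numLeaves)) p))))
      (fun F => by
        rw [sum_exchange hV fun p => F (exchange (seg (a + l.numLeaves + c.numLeaves) r.numLeaves)
          (exchange (seg (a + l.numLeaves) c.numLeaves) (exchange (seg a l.numLeaves) p))),
          sum_exchange hl.isModule fun p =>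
            F (exchange (seg (a + l.numLeaves + c.numLeaves) r.numLeaves)
            (exchange (seg (a + l.numLeaves) c.numLeaves) p)),
          sum_exchange hc.isModule fun p =>
            F (exchange (seg (a + l.numLeaves + c.numLeaves) r.numLeaves) p),
          sum_exchange hr.isModule])
      fun p => sortAll_exchange p _ _ _ _
    rw [exchangeForm, ← sum_exchange hV] at el
    rw [exchangeForm, ← sum_exchange hl.isModule, ← sum_exchange hV] at ec
    rw [exchangeForm, ← sum_exchange hc.isModule, ← sum_exchange hl.isModule,
      ← sum_exchange hV] at er
    have e0' := e0.trans_eq (show _ = (1 : ℝ) ^ 2 * _ by rw [one_pow, one_mul])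
    have s1 := sum_sq_sub_le hw one_pos (by linarith) e0' er
    have s2 := sum_sq_sub_le hw (by linarith) (by linarith) s1 ec
    have s3 := sum_sq_sub_le hw (by linarith) (by linarith) s2 el
    refine ((Finset.sum_congr rfl fun p _ => ?_).trans_le s3).trans
      (mul_le_mul_of_nonneg_right ?_ hε)
    · simp only [STree.numLeaves]
      ring
    · simp only [STree.numLeaves]
      push_cast
      gcongr
      · linarith
      · linarith

theorem sum_sq_le_descentForm {q : Fin (m + 1) → Fin (m + 1) → ℝ} {qb : ℝ}
    (hq0 : ∀ u v, u < v → 0 < q u v) (hq : ∀ u v, u < v → q u v ≤ qb) (hqb : 0 ≤ qb)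
    (hqb2 : qb < 1 / 2) {f : Equiv.Perm (Fin (m + 1)) → ℝ} {T : STree}
    (hT : ModularAt q 0 T) (hn : T.numLeaves = m + 1) (hf : ∑ σ, permWeight q σ * f σ = 0) :
    ∑ σ, permWeight q σ * f σ ^ 2 ≤
      8 * sortConst qb 4 * ((m : ℝ) + 1) ^ 2 * descentForm q f := by
  have h1 := exchangeForm_le hq0 hq hqb hqb2 f T 0 hT
  have hs : (seg 0 T.numLeaves : Finset (Fin (m + 1))) = univ := by
    ext x
    have := x.2
    simp only [mem_seg, Finset.mem_univ, iff_true]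
    omega
  have hex : ∀ p : Equiv.Perm (Fin (m + 1)) × Equiv.Perm (Fin (m + 1)),
      (exchange univ p).1 = p.2 := fun p =>
    perm_eq_of_agree (V := univ) (fun a ha => absurd (Finset.mem_univ a) ha)
      fun a ha b hb => (reorder_lt_iff _ _ ha hb).1
  have hZ : 0 < ∑ σ, permWeight q σ :=
    Finset.sum_pos (fun σ _ => permWeight_pos hq0 σ) ⟨1, Finset.mem_univ _⟩
  have h2 : exchangeForm q univ f =
      2 * (∑ σ, permWeight q σ) * ∑ σ, permWeight q σ * f σ ^ 2 := by
    have e1 : exchangeForm q univ f =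
        ∑ σ, ∑ τ, (permWeight q σ * f σ ^ 2 * permWeight q τ +
          permWeight q σ * (permWeight q τ * f τ ^ 2) -
          2 * ((permWeight q σ * f σ) * (permWeight q τ * f τ))) := by
      rw [exchangeForm, Fintype.sum_prod_type]
      refine Finset.sum_congr rfl fun σ _ => Finset.sum_congr rfl fun τ _ => ?_
      rw [hex]
      ring
    rw [e1]
    simp only [Finset.sum_sub_distrib, Finset.sum_add_distrib, ← Finset.mul_sum, hf,
      ← Finset.sum_mul]
    ring
  rw [hs, h2, hn] at h1
  have hc : 0 ≤ sortConst qb 4 * descentForm q f :=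
    le_trans (Finset.sum_nonneg fun σ _ => mul_nonneg (permWeight_pos hq0 σ).le (sq_nonneg _))
      (sum_sub_sortAll_le hq0 hq hqb hqb2 [0, 0, 0, 0] f)
  have h3 : (2 * ((m + 1 : ℕ) : ℝ) - 1) ^ 2 ≤ 4 * ((m : ℝ) + 1) ^ 2 := by
    push_cast
    have : (0 : ℝ) ≤ m := Nat.cast_nonneg m
    nlinarith
  have h4 := mul_le_mul_of_nonneg_right h3 hc
  have h5 : (∑ σ, permWeight q σ) * (∑ σ, permWeight q σ * f σ ^ 2) ≤
      (∑ σ, permWeight q σ) * (8 * sortConst qb 4 * ((m : ℝ) + 1) ^ 2 * descentForm q f) := by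
    nlinarith [mul_le_mul_of_nonneg_left h4 hZ.le]
  exact le_of_mul_le_mul_left h5 hZ

end Poincare

section Chain

variable {m : ℕ}

/-- The probability of swapping adjacent entries `a, b`, when the probability of ordering
`u < v` increasingly is `1 / (1 + q u v)`. -/
noncomputable def swapProb {n : ℕ} (q : Fin n → Fin n → ℝ) (a b : Fin n) : ℝ :=
  if a < b then q a b / (1 + q a b) else 1 / (1 + q b a)

theorem swapProb_add {n : ℕ} {q : Fin n → Fin n → ℝ} (hq0 : ∀ u v, u < v → 0 < q u v)
    {a b : Fin n} (h : a ≠ b) : swapProb q a b + swapProb q b a = 1 := by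
  rcases h.lt_or_gt with h | h
  · have := hq0 _ _ h
    rw [swapProb, swapProb, if_pos h, if_neg h.not_gt]
    field_simp
    ring
  · have := hq0 _ _ h
    rw [swapProb, swapProb, if_neg h.not_gt, if_pos h]
    field_simp

theorem swapProb_nonneg {n : ℕ} {q : Fin n → Fin n → ℝ} (hq0 : ∀ u v, u < v → 0 < q u v)
    {a b : Fin n} (h : a ≠ b) : 0 ≤ swapProb q a b := by
  rcases h.lt_or_gt with h | h
  · have := hq0 _ _ h
    rw [swapProb, if_pos h]
    positivity
  · have := hq0 _ _ h
    rw [swapProb, if_neg h.not_gt]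
    positivity

theorem swapProb_le_one {n : ℕ} {q : Fin n → Fin n → ℝ} (hq0 : ∀ u v, u < v → 0 < q u v)
    {a b : Fin n} (h : a ≠ b) : swapProb q a b ≤ 1 := by
  linarith [swapProb_add hq0 h, swapProb_nonneg hq0 h.symm]

theorem apply_castSucc_ne_succ (σ : Equiv.Perm (Fin (m + 1))) (i : Fin m) :
    σ i.castSucc ≠ σ i.succ :=
  σ.injective.ne (Fin.castSucc_lt_succ (i := i)).ne

/-- The averaging operator of the move at positions `i` and `i + 1`. -/
noncomputable def stepOp (q : Fin (m + 1) → Fin (m + 1) → ℝ) (i : Fin m)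
    (f : Equiv.Perm (Fin (m + 1)) → ℝ) (σ : Equiv.Perm (Fin (m + 1))) : ℝ :=
  (1 - swapProb q (σ i.castSucc) (σ i.succ)) * f σ +
    swapProb q (σ i.castSucc) (σ i.succ) * f (σ * adj i)

/-- The averaging operator of the adjacent transposition chain. -/
noncomputable def chainOp (q : Fin (m + 1) → Fin (m + 1) → ℝ)
    (f : Equiv.Perm (Fin (m + 1)) → ℝ) (σ : Equiv.Perm (Fin (m + 1))) : ℝ :=
  (1 / (m : ℝ)) * ∑ i, stepOp q i f σ

theorem sum_mul_adj (i : Fin m) (F : Equiv.Perm (Fin (m + 1)) → ℝ) :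
    ∑ σ, F (σ * adj i) = ∑ σ, F σ :=
  Equiv.sum_comp (Equiv.mulRight (adj i)) F

theorem permWeight_mul_swapProb (q : Fin (m + 1) → Fin (m + 1) → ℝ)
    (σ : Equiv.Perm (Fin (m + 1))) (i : Fin m) :
    permWeight q (σ * adj i) * swapProb q (σ i.succ) (σ i.castSucc) =
      permWeight q σ * swapProb q (σ i.castSucc) (σ i.succ) := by
  rcases (apply_castSucc_ne_succ σ i).lt_or_gt with h | h
  · have h1 := permWeight_of_descent q (σ * adj i) (i := i) (by simpa using h)
    simp only [Equiv.Perm.mul_apply, adj_succ, adj_castSucc, mul_adj_mul_adj] at h1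
    rw [h1, swapProb, swapProb, if_pos h, if_neg h.not_gt]
    ring
  · rw [permWeight_of_descent q σ h, swapProb, swapProb, if_pos h, if_neg h.not_gt]
    ring

theorem sum_stepOp (q : Fin (m + 1) → Fin (m + 1) → ℝ) (i : Fin m)
    (f : Equiv.Perm (Fin (m + 1)) → ℝ) :
    ∑ σ, permWeight q σ * stepOp q i f σ = ∑ σ, permWeight q σ * f σ := by
  have h1 := sum_mul_adj i fun σ =>
    permWeight q (σ * adj i) * swapProb q (σ i.succ) (σ i.castSucc) * f (σ * adj i)
  simp only [mul_adj_mul_adj, Equiv.Perm.mul_apply, adj_succ, adj_castSucc,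
    permWeight_mul_swapProb q] at h1
  calc ∑ σ, permWeight q σ * stepOp q i f σ
      = ∑ σ, permWeight q σ * f σ +
        (∑ σ, permWeight q σ * swapProb q (σ i.castSucc) (σ i.succ) * f (σ * adj i) -
        ∑ σ, permWeight q σ * swapProb q (σ i.castSucc) (σ i.succ) * f σ) := by
        rw [← Finset.sum_sub_distrib, ← Finset.sum_add_distrib]
        refine Finset.sum_congr rfl fun σ _ => ?_
        rw [stepOp]
        ring
    _ = ∑ σ, permWeight q σ * f σ := by rw [h1, sub_self, add_zero]

theorem sum_chainOp (q : Fin (m + 1) → Fin (m + 1) → ℝ)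
    (hm : 0 < m) (f : Equiv.Perm (Fin (m + 1)) → ℝ) :
    ∑ σ, permWeight q σ * chainOp q f σ = ∑ σ, permWeight q σ * f σ := by
  have hm' : (m : ℝ) ≠ 0 := by exact_mod_cast hm.ne'
  have : ∀ σ, permWeight q σ * chainOp q f σ =
      (1 / (m : ℝ)) * ∑ i, permWeight q σ * stepOp q i f σ := fun σ => by
    rw [chainOp, Finset.mul_sum, Finset.mul_sum, Finset.mul_sum]
    exact Finset.sum_congr rfl fun i _ => by ring
  simp only [this]
  rw [← Finset.mul_sum, Finset.sum_comm]
  simp only [sum_stepOp q]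
  rw [Finset.sum_const, Finset.card_univ, Fintype.card_fin, nsmul_eq_mul]
  field_simp

theorem sum_sq_stepOp_le {q : Fin (m + 1) → Fin (m + 1) → ℝ} (hq0 : ∀ u v, u < v → 0 < q u v)
    (hq : ∀ u v, u < v → q u v ≤ 1) (i : Fin m) (f : Equiv.Perm (Fin (m + 1)) → ℝ) :
    ∑ σ, permWeight q σ * stepOp q i f σ ^ 2 ≤ ∑ σ, permWeight q σ * f σ ^ 2 -
      (1 / 4) * ∑ σ, (if σ i.succ < σ i.castSucc then
        permWeight q σ * (f σ - f (σ * adj i)) ^ 2 else 0) := by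
  have h1 := sum_stepOp q i fun σ => f σ ^ 2
  have h2 : ∑ σ, permWeight q σ * stepOp q i f σ ^ 2 =
      ∑ σ, permWeight q σ * stepOp q i (fun σ => f σ ^ 2) σ -
      ∑ σ, permWeight q σ * (swapProb q (σ i.castSucc) (σ i.succ) *
        (1 - swapProb q (σ i.castSucc) (σ i.succ)) * (f σ - f (σ * adj i)) ^ 2) := by
    rw [← Finset.sum_sub_distrib]
    refine Finset.sum_congr rfl fun σ _ => ?_
    rw [stepOp, stepOp]
    ring
  rw [h2, h1]
  refine sub_le_sub_left ?_ _
  rw [← sum_mul_adj i fun σ => permWeight q σ * (swapProb q (σ i.castSucc) (σ i.succ) *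
        (1 - swapProb q (σ i.castSucc) (σ i.succ)) * (f σ - f (σ * adj i)) ^ 2), Finset.mul_sum]
  refine Finset.sum_le_sum fun σ _ => ?_
  simp only [mul_adj_mul_adj, Equiv.Perm.mul_apply, adj_succ, adj_castSucc]
  have hne := apply_castSucc_ne_succ σ i
  have h3 := swapProb_nonneg hq0 hne.symm
  have h4 := swapProb_le_one hq0 hne.symm
  have h5 := permWeight_pos hq0 (σ * adj i)
  split_ifs with h
  · have h6 := permWeight_mul_swapProb q σ i
    have h7 : swapProb q (σ i.castSucc) (σ i.succ) = 1 / (1 + q (σ i.succ) (σ i.castSucc)) := by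
      rw [swapProb, if_neg h.not_gt]
    have h8 := swapProb_add hq0 hne
    have h9 : (1 / 2 : ℝ) ≤ swapProb q (σ i.castSucc) (σ i.succ) := by
      rw [h7]
      have := hq0 _ _ h
      exact one_div_le_one_div_of_le (by linarith) (by linarith [hq _ _ h])
    have h10 : permWeight q (σ * adj i) * (swapProb q (σ i.succ) (σ i.castSucc) *
        (1 - swapProb q (σ i.succ) (σ i.castSucc)) * (f (σ * adj i) - f σ) ^ 2) =
        (permWeight q σ * (f σ - f (σ * adj i)) ^ 2) *
          swapProb q (σ i.castSucc) (σ i.succ) ^ 2 := by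
      rw [← eq_sub_iff_add_eq] at h8
      rw [show 1 - swapProb q (σ i.succ) (σ i.castSucc) = swapProb q (σ i.castSucc) (σ i.succ)
        from h8.symm]
      linear_combination (swapProb q (σ i.castSucc) (σ i.succ) * (f σ - f (σ * adj i)) ^ 2) * h6
    rw [h10, mul_comm]
    have := (permWeight_pos hq0 σ).le
    refine mul_le_mul_of_nonneg_left ?_ (by positivity)
    nlinarith
  · rw [mul_zero]
    have : 0 ≤ 1 - swapProb q (σ i.succ) (σ i.castSucc) := by linarith
    positivity

theorem sum_sq_chainOp_le {q : Fin (m + 1) → Fin (m + 1) → ℝ} (hq0 : ∀ u v, u < v → 0 < q u v)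
    (hq : ∀ u v, u < v → q u v ≤ 1) (hm : 0 < m) (f : Equiv.Perm (Fin (m + 1)) → ℝ) :
    ∑ σ, permWeight q σ * chainOp q f σ ^ 2 ≤ ∑ σ, permWeight q σ * f σ ^ 2 -
      (1 / (4 * (m : ℝ))) * descentForm q f := by
  have hm' : (0 : ℝ) < m := by exact_mod_cast hm
  have h1 : ∑ σ, permWeight q σ * chainOp q f σ ^ 2 ≤
      (1 / (m : ℝ)) * ∑ i, ∑ σ, permWeight q σ * stepOp q i f σ ^ 2 := by
    rw [Finset.sum_comm, Finset.mul_sum]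
    refine Finset.sum_le_sum fun σ _ => ?_
    have h2 := sq_sum_le_card_mul_sum_sq (s := (univ : Finset (Fin m)))
      (f := fun i => stepOp q i f σ)
    rw [Finset.card_univ, Fintype.card_fin] at h2
    rw [chainOp, ← Finset.mul_sum, mul_pow]
    have h3 : (1 / (m : ℝ)) ^ 2 * (∑ i, stepOp q i f σ) ^ 2 ≤
        (1 / (m : ℝ)) * ∑ i, stepOp q i f σ ^ 2 := by
      calc (1 / (m : ℝ)) ^ 2 * (∑ i, stepOp q i f σ) ^ 2
          ≤ (1 / (m : ℝ)) ^ 2 * (m * ∑ i, stepOp q i f σ ^ 2) := by gcongr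
        _ = (1 / (m : ℝ)) * ∑ i, stepOp q i f σ ^ 2 := by field_simp
    have h4 := mul_le_mul_of_nonneg_left h3 (permWeight_pos hq0 σ).le
    linarith
  have h5 := Finset.sum_le_sum fun (i : Fin m) (_ : i ∈ univ) => sum_sq_stepOp_le hq0 hq i f
  rw [Finset.sum_sub_distrib, ← Finset.mul_sum, Finset.sum_comm (s := univ) (t := univ)
    (f := fun (i : Fin m) σ => if σ i.succ < σ i.castSucc then
        permWeight q σ * (f σ - f (σ * adj i)) ^ 2 else 0), Finset.sum_const, Finset.card_univ,
    Fintype.card_fin, nsmul_eq_mul] at h5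
  refine h1.trans ((mul_le_mul_of_nonneg_left h5 (by positivity)).trans (le_of_eq ?_))
  rw [descentForm]
  field_simp

theorem stepOp_const (q : Fin (m + 1) → Fin (m + 1) → ℝ) (i : Fin m)
    (f : Equiv.Perm (Fin (m + 1)) → ℝ) (c : ℝ) (σ : Equiv.Perm (Fin (m + 1))) :
    stepOp q i (fun τ => f τ - c) σ = stepOp q i f σ - c := by
  rw [stepOp, stepOp]
  ring

theorem chainOp_sub_const (q : Fin (m + 1) → Fin (m + 1) → ℝ) (hm : 0 < m)
    (f : Equiv.Perm (Fin (m + 1)) → ℝ) (c : ℝ) :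
    chainOp q (fun τ => f τ - c) = fun σ => chainOp q f σ - c := by
  have hm' : (m : ℝ) ≠ 0 := by exact_mod_cast hm.ne'
  funext σ
  simp only [chainOp, stepOp_const, Finset.sum_sub_distrib]
  rw [Finset.sum_const, Finset.card_univ, Fintype.card_fin, nsmul_eq_mul]
  field_simp

theorem iterate_chainOp_sub_const (q : Fin (m + 1) → Fin (m + 1) → ℝ) (hm : 0 < m) (t : ℕ)
    (f : Equiv.Perm (Fin (m + 1)) → ℝ) (c : ℝ) :
    (chainOp q)^[t] (fun τ => f τ - c) = fun σ => (chainOp q)^[t] f σ - c := by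
  induction t with
  | zero => rfl
  | succ t ih => rw [Function.iterate_succ_apply', ih, chainOp_sub_const q hm,
      Function.iterate_succ_apply']

theorem sum_iterate_chainOp (q : Fin (m + 1) → Fin (m + 1) → ℝ)
    (hm : 0 < m) (t : ℕ) (f : Equiv.Perm (Fin (m + 1)) → ℝ) :
    ∑ σ, permWeight q σ * (chainOp q)^[t] f σ = ∑ σ, permWeight q σ * f σ := by
  induction t with
  | zero => rfl
  | succ t ih => rw [Function.iterate_succ_apply', sum_chainOp q hm, ih]

theorem abs_chainOp_le {q : Fin (m + 1) → Fin (m + 1) → ℝ}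
    (hq0 : ∀ u v, u < v → 0 < q u v) (hm : 0 < m) {f : Equiv.Perm (Fin (m + 1)) → ℝ} {c : ℝ}
    (hf : ∀ σ, |f σ| ≤ c) (σ : Equiv.Perm (Fin (m + 1))) : |chainOp q f σ| ≤ c := by
  have hm' : (0 : ℝ) < m := by exact_mod_cast hm
  have h1 : ∀ i, |stepOp q i f σ| ≤ c := fun i => by
    have hne := apply_castSucc_ne_succ σ i
    have h3 := swapProb_nonneg hq0 hne
    have h4 := swapProb_le_one hq0 hne
    have h5 := abs_le.1 (hf σ)
    have h6 := abs_le.1 (hf (σ * adj i))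
    rw [stepOp, abs_le]
    constructor <;> nlinarith
  rw [chainOp, abs_mul, abs_of_pos (by positivity), div_mul_eq_mul_div, one_mul,
    div_le_iff₀ hm']
  refine (Finset.abs_sum_le_sum_abs _ _).trans ((Finset.sum_le_sum fun i _ => h1 i).trans ?_)
  rw [Finset.sum_const, Finset.card_univ, Fintype.card_fin, nsmul_eq_mul, mul_comm]

theorem abs_iterate_chainOp_le {q : Fin (m + 1) → Fin (m + 1) → ℝ}
    (hq0 : ∀ u v, u < v → 0 < q u v) (hm : 0 < m) {f : Equiv.Perm (Fin (m + 1)) → ℝ} {c : ℝ}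
    (hf : ∀ σ, |f σ| ≤ c) (t : ℕ) (σ : Equiv.Perm (Fin (m + 1))) :
    |(chainOp q)^[t] f σ| ≤ c := by
  induction t generalizing σ with
  | zero => exact hf σ
  | succ t ih =>
    rw [Function.iterate_succ_apply']
    exact abs_chainOp_le hq0 hm ih σ

theorem chainOp_sub (q : Fin (m + 1) → Fin (m + 1) → ℝ)
    (f g : Equiv.Perm (Fin (m + 1)) → ℝ) (σ : Equiv.Perm (Fin (m + 1))) :
    chainOp q f σ - chainOp q g σ = chainOp q (fun τ => f τ - g τ) σ := by
  rw [chainOp, chainOp, chainOp, ← mul_sub, ← Finset.sum_sub_distrib]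
  congr 1
  refine Finset.sum_congr rfl fun i _ => ?_
  simp only [stepOp]
  ring

theorem abs_chainOp_sub_chainOp_le {q q' : Fin (m + 1) → Fin (m + 1) → ℝ} (hm : 0 < m) {δ : ℝ}
    (h : ∀ a b, a ≠ b → |swapProb q a b - swapProb q' a b| ≤ δ)
    {f : Equiv.Perm (Fin (m + 1)) → ℝ} (hf : ∀ σ, |f σ| ≤ 1) (σ : Equiv.Perm (Fin (m + 1))) :
    |chainOp q f σ - chainOp q' f σ| ≤ 2 * δ := by
  have hm' : (0 : ℝ) < m := by exact_mod_cast hm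
  have h1 : ∀ i, |stepOp q i f σ - stepOp q' i f σ| ≤ 2 * δ := fun i => by
    have h2 := h _ _ (apply_castSucc_ne_succ σ i)
    have h3 : |f (σ * adj i) - f σ| ≤ 2 :=
      (abs_sub _ _).trans (by linarith [hf σ, hf (σ * adj i)])
    have h4 : stepOp q i f σ - stepOp q' i f σ = (f (σ * adj i) - f σ) *
        (swapProb q (σ i.castSucc) (σ i.succ) - swapProb q' (σ i.castSucc) (σ i.succ)) := by
      rw [stepOp, stepOp]
      ring
    rw [h4, abs_mul]
    exact mul_le_mul h3 h2 (abs_nonneg _) (by norm_num)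
  rw [chainOp, chainOp, ← mul_sub, ← Finset.sum_sub_distrib, abs_mul,
    abs_of_pos (by positivity), div_mul_eq_mul_div, one_mul, div_le_iff₀ hm']
  refine (Finset.abs_sum_le_sum_abs _ _).trans ((Finset.sum_le_sum fun i _ => h1 i).trans ?_)
  rw [Finset.sum_const, Finset.card_univ, Fintype.card_fin, nsmul_eq_mul, mul_comm]

theorem abs_iterate_chainOp_sub_le {q q' : Fin (m + 1) → Fin (m + 1) → ℝ}
    (hq0 : ∀ u v, u < v → 0 < q u v) (hq0' : ∀ u v, u < v → 0 < q' u v) (hm : 0 < m) {δ : ℝ}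
    (h : ∀ a b, a ≠ b → |swapProb q a b - swapProb q' a b| ≤ δ)
    {f : Equiv.Perm (Fin (m + 1)) → ℝ} (hf : ∀ σ, |f σ| ≤ 1) (t : ℕ)
    (σ : Equiv.Perm (Fin (m + 1))) :
    |(chainOp q)^[t] f σ - (chainOp q')^[t] f σ| ≤ t * (2 * δ) := by
  induction t generalizing σ with
  | zero => simp
  | succ t ih =>
    rw [Function.iterate_succ_apply', Function.iterate_succ_apply']
    have h1 := abs_chainOp_sub_chainOp_le hm h (abs_iterate_chainOp_le hq0' hm hf t) σ
    have h2 := abs_chainOp_le hq0 hm ih σ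
    rw [← chainOp_sub] at h2
    push_cast
    calc _ ≤ _ := abs_sub_le _ (chainOp q ((chainOp q')^[t] f) σ) _
      _ ≤ _ := by linarith

theorem one_le_sortConst {qb : ℝ} (hqb : 0 ≤ qb) (hqb2 : qb < 1 / 2) (k : ℕ) :
    1 ≤ sortConst qb (k + 1) := by
  have h0 : 0 < 1 - 2 * qb := by linarith
  have h1 : 2 ≤ 2 / (1 - 2 * qb) := by
    rw [le_div_iff₀ h0]
    linarith
  have h2 : ∀ k, 0 ≤ sortConst qb k := fun k => by
    induction k with
    | zero => exact le_rfl
    | succ k ih => rw [sortConst]; positivity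
  have h3 := mul_nonneg (one_div_pos.2 h0).le (h2 k)
  rw [sortConst]
  nlinarith

theorem sum_sq_iterate_chainOp_le {q : Fin (m + 1) → Fin (m + 1) → ℝ} {qb : ℝ}
    (hq0 : ∀ u v, u < v → 0 < q u v) (hq : ∀ u v, u < v → q u v ≤ qb) (hqb : 0 ≤ qb)
    (hqb2 : qb < 1 / 2) (hm : 0 < m) {T : STree} (hT : ModularAt q 0 T)
    (hn : T.numLeaves = m + 1) {f : Equiv.Perm (Fin (m + 1)) → ℝ}
    (hf : ∑ σ, permWeight q σ * f σ = 0) (t : ℕ) :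
    ∑ σ, permWeight q σ * (chainOp q)^[t] f σ ^ 2 ≤
      (1 - 1 / (32 * sortConst qb 4 * ((m : ℝ) + 1) ^ 3)) ^ t *
        ∑ σ, permWeight q σ * f σ ^ 2 := by
  have hm' : (0 : ℝ) < m := by exact_mod_cast hm
  have hs := one_le_sortConst hqb hqb2 3
  have hs0 : 0 < sortConst qb 4 := one_pos.trans_le hs
  induction t with
  | zero => simp
  | succ t ih =>
    rw [Function.iterate_succ_apply', pow_succ', mul_assoc]
    obtain ⟨g, hg⟩ : ∃ g, g = (chainOp q)^[t] f := ⟨_, rfl⟩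
    rw [← hg] at ih ⊢
    have h1 := sum_sq_chainOp_le hq0 (fun u v h => (hq u v h).trans (by linarith)) hm g
    have h2 := sum_sq_le_descentForm hq0 hq hqb hqb2 hT hn (f := g)
      (by rw [hg, sum_iterate_chainOp q hm, hf])
    have hd : 0 ≤ descentForm q g :=
      Finset.sum_nonneg fun σ _ => Finset.sum_nonneg fun i _ => by
        have := (permWeight_pos hq0 σ).le
        split_ifs <;> positivity
    have h3 : (1 / (32 * sortConst qb 4 * ((m : ℝ) + 1) ^ 3)) *
        ∑ σ, permWeight q σ * g σ ^ 2 ≤ (1 / (4 * (m : ℝ))) * descentForm q g := by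
      calc _ ≤ (1 / (32 * sortConst qb 4 * ((m : ℝ) + 1) ^ 3)) *
            (8 * sortConst qb 4 * ((m : ℝ) + 1) ^ 2 * descentForm q g) := by gcongr
        _ = (1 / (4 * ((m : ℝ) + 1))) * descentForm q g := by
            field_simp
            ring
        _ ≤ _ := by
            refine mul_le_mul_of_nonneg_right ?_ hd
            exact one_div_le_one_div_of_le (by positivity) (by linarith)
    have h4 : (0 : ℝ) ≤ 1 - 1 / (32 * sortConst qb 4 * ((m : ℝ) + 1) ^ 3) := by
      rw [sub_nonneg, div_le_one (by positivity)]
      have : (1 : ℝ) ≤ ((m : ℝ) + 1) ^ 3 := one_le_pow₀ (by linarith)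
      nlinarith
    have h5 := mul_le_mul_of_nonneg_left ih h4
    linarith

end Chain

section Truncation

theorem IsModule.max_const {n : ℕ} {q : Fin n → Fin n → ℝ} {V : Finset (Fin n)}
    (h : IsModule q V) (δ : ℝ) : IsModule (fun u v => max (q u v) δ) V := by
  intro x hx y hy u hu
  obtain ⟨h1, h2, h3⟩ := h x hx y hy u hu
  exact ⟨h1, fun hlt => by simp only [h2 hlt], fun hlt => by simp only [h3 hlt]⟩

theorem ModularAt.max_const {n : ℕ} {q : Fin n → Fin n → ℝ} {a : ℕ} {T : STree}
    (h : ModularAt q a T) (δ : ℝ) : ModularAt (fun u v => max (q u v) δ) a T := by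
  induction T generalizing a with
  | leaf => exact IsModule.max_const h δ
  | node sL sC sR l c r ihl ihc ihr =>
    exact ⟨IsModule.max_const h.1 δ, ihl h.2.1, ihc h.2.2.1, ihr h.2.2.2⟩

theorem abs_swapProb_sub_max_le {n : ℕ} {q : Fin n → Fin n → ℝ}
    (hq0 : ∀ u v, u < v → 0 < q u v) {δ : ℝ} (hδ : 0 ≤ δ) (a b : Fin n) (hab : a ≠ b) :
    |swapProb q a b - swapProb (fun u v => max (q u v) δ) a b| ≤ δ := by
  have key : ∀ x : ℝ, 0 < x → 0 ≤ 1 / (1 + x) - 1 / (1 + max x δ) ∧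
      1 / (1 + x) - 1 / (1 + max x δ) ≤ δ := fun x hx => by
    have h1 : x ≤ max x δ := le_max_left _ _
    have h2 : max x δ ≤ x + δ := max_le (by linarith) (by linarith)
    have h3 : 0 < 1 + max x δ := by linarith
    have h4 : 1 / (1 + x) - 1 / (1 + max x δ) = (max x δ - x) / ((1 + x) * (1 + max x δ)) := by
      field_simp
      ring
    rw [h4]
    refine ⟨div_nonneg (by linarith) (by positivity), ?_⟩
    rw [div_le_iff₀ (by positivity)]
    have : 1 ≤ (1 + x) * (1 + max x δ) := one_le_mul_of_one_le_of_one_le (by linarith)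
      (by linarith)
    nlinarith
  rcases hab.lt_or_gt with h | h
  · obtain ⟨h1, h2⟩ := key _ (hq0 _ _ h)
    have h3 := hq0 _ _ h
    have h4 : 0 < max (q a b) δ := lt_max_of_lt_left h3
    rw [swapProb, swapProb, if_pos h, if_pos h, abs_le]
    have e : ∀ x : ℝ, 0 < x → x / (1 + x) = 1 - 1 / (1 + x) := fun x hx => by
      field_simp
      ring
    rw [e _ h3, e _ h4]
    constructor <;> linarith
  · obtain ⟨h1, h2⟩ := key _ (hq0 _ _ h)
    rw [swapProb, swapProb, if_neg h.not_gt, if_neg h.not_gt, abs_le]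
    constructor <;> linarith

theorem permWeight_le_one {n : ℕ} {q : Fin n → Fin n → ℝ} (hq0 : ∀ u v, u < v → 0 < q u v)
    (hq : ∀ u v, u < v → q u v ≤ 1) (σ : Equiv.Perm (Fin n)) : permWeight q σ ≤ 1 := by
  have h : ∀ u v : Fin n, 0 ≤ (if u < v ∧ σ.symm v < σ.symm u then q u v else 1) ∧
      (if u < v ∧ σ.symm v < σ.symm u then q u v else 1) ≤ 1 := fun u v => by
    split_ifs with h
    · exact ⟨(hq0 _ _ h.1).le, hq _ _ h.1⟩
    · exact ⟨zero_le_one, le_rfl⟩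
  exact Finset.prod_le_one (fun u _ => Finset.prod_nonneg fun v _ => (h u v).1) fun u _ =>
    Finset.prod_le_one (fun v _ => (h u v).1) fun v _ => (h u v).2

theorem pow_le_permWeight {n : ℕ} {q : Fin n → Fin n → ℝ} {δ : ℝ} (hδ : 0 ≤ δ) (hδ1 : δ ≤ 1)
    (hq : ∀ u v, u < v → δ ≤ q u v) (σ : Equiv.Perm (Fin n)) :
    δ ^ (n * n) ≤ permWeight q σ := by
  have h1 : δ ^ (n * n) = ∏ _u : Fin n, ∏ _v : Fin n, δ := by
    simp [pow_mul]
  rw [h1, permWeight]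
  refine Finset.prod_le_prod (fun u _ => Finset.prod_nonneg fun v _ => hδ) fun u _ =>
    Finset.prod_le_prod (fun v _ => hδ) fun v _ => ?_
  split_ifs with h
  · exact hq _ _ h.1
  · exact hδ1

end Truncation

section Mixing

variable {m : ℕ}

/-- The mean of `f` under the distribution proportional to `permWeight q`. -/
noncomputable def permMean {n : ℕ} (q : Fin n → Fin n → ℝ) (f : Equiv.Perm (Fin n) → ℝ) : ℝ :=
  (∑ σ, permWeight q σ * f σ) / ∑ σ, permWeight q σ

theorem sum_permWeight_pos {n : ℕ} {q : Fin n → Fin n → ℝ} (hq0 : ∀ u v, u < v → 0 < q u v) :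
    0 < ∑ σ, permWeight q σ :=
  Finset.sum_pos (fun σ _ => permWeight_pos hq0 σ) ⟨1, Finset.mem_univ _⟩

theorem permWeight_mul_sq_iterate_sub_le {q : Fin (m + 1) → Fin (m + 1) → ℝ} {qb : ℝ}
    (hq0 : ∀ u v, u < v → 0 < q u v) (hq : ∀ u v, u < v → q u v ≤ qb) (hqb : 0 ≤ qb)
    (hqb2 : qb < 1 / 2) (hm : 0 < m) {T : STree} (hT : ModularAt q 0 T)
    (hn : T.numLeaves = m + 1) {g : Equiv.Perm (Fin (m + 1)) → ℝ}
    (hg : ∀ σ, |g σ| ≤ 1) (t : ℕ) (x : Equiv.Perm (Fin (m + 1))) :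
    permWeight q x * ((chainOp q)^[t] g x - permMean q g) ^ 2 ≤
      Real.exp (-(t / (32 * sortConst qb 4 * ((m : ℝ) + 1) ^ 3))) * ∑ σ, permWeight q σ := by
  have hZ := sum_permWeight_pos hq0
  have hs0 : 0 < sortConst qb 4 := one_pos.trans_le (one_le_sortConst hqb hqb2 3)
  have hmean : (∑ σ, permWeight q σ) * permMean q g = ∑ σ, permWeight q σ * g σ := by
    rw [permMean]
    field_simp
  have hf : ∑ σ, permWeight q σ * (g σ - permMean q g) = 0 := by
    simp only [mul_sub, Finset.sum_sub_distrib, ← Finset.sum_mul, hmean, sub_self]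
  have h1 := sum_sq_iterate_chainOp_le hq0 hq hqb hqb2 hm hT hn hf t
  rw [iterate_chainOp_sub_const q hm] at h1
  have h2 : permWeight q x * ((chainOp q)^[t] g x - permMean q g) ^ 2 ≤
      ∑ σ, permWeight q σ * ((chainOp q)^[t] g σ - permMean q g) ^ 2 :=
    Finset.single_le_sum (f := fun σ => permWeight q σ * ((chainOp q)^[t] g σ - permMean q g) ^ 2)
      (fun σ _ => mul_nonneg (permWeight_pos hq0 σ).le (sq_nonneg _)) (Finset.mem_univ x)
  have h3 : ∑ σ, permWeight q σ * (g σ - permMean q g) ^ 2 ≤ ∑ σ, permWeight q σ := by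
    have e : ∑ σ, permWeight q σ * (g σ - permMean q g) ^ 2 =
        ∑ σ, permWeight q σ * g σ ^ 2 - (∑ σ, permWeight q σ) * permMean q g ^ 2 := by
      have e2 : ∀ σ, permWeight q σ * (g σ - permMean q g) ^ 2 = permWeight q σ * g σ ^ 2 -
          2 * permMean q g * (permWeight q σ * g σ) + permWeight q σ * permMean q g ^ 2 :=
        fun σ => by ring
      simp only [e2, Finset.sum_add_distrib, Finset.sum_sub_distrib, ← Finset.mul_sum,
        ← Finset.sum_mul, ← hmean]
      ring
    have h4 : ∑ σ, permWeight q σ * g σ ^ 2 ≤ ∑ σ, permWeight q σ := by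
      refine Finset.sum_le_sum fun σ _ => ?_
      have : g σ ^ 2 ≤ 1 := (sq_le_one_iff_abs_le_one _).2 (hg σ)
      nlinarith [permWeight_pos hq0 σ]
    rw [e]
    nlinarith [mul_nonneg hZ.le (sq_nonneg (permMean q g))]
  have hΛ : 1 ≤ 32 * sortConst qb 4 * ((m : ℝ) + 1) ^ 3 := by
    have : (1 : ℝ) ≤ ((m : ℝ) + 1) ^ 3 := one_le_pow₀ (by linarith [Nat.cast_nonneg (α := ℝ) m])
    nlinarith [one_le_sortConst hqb hqb2 3]
  have h5 : (1 - 1 / (32 * sortConst qb 4 * ((m : ℝ) + 1) ^ 3)) ^ t ≤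
      Real.exp (-(t / (32 * sortConst qb 4 * ((m : ℝ) + 1) ^ 3))) := by
    have h6 : Real.exp (-(t / (32 * sortConst qb 4 * ((m : ℝ) + 1) ^ 3))) =
        Real.exp (-(1 / (32 * sortConst qb 4 * ((m : ℝ) + 1) ^ 3))) ^ t := by
      rw [← Real.exp_nat_mul]
      congr 1
      ring
    rw [h6]
    refine pow_le_pow_left₀ ?_ ?_ t
    · rw [sub_nonneg]
      exact (div_le_one (by linarith)).2 hΛ
    · linarith [Real.add_one_le_exp (-(1 / (32 * sortConst qb 4 * ((m : ℝ) + 1) ^ 3)))]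
  exact h2.trans (h1.trans (mul_le_mul h5 h3 (Finset.sum_nonneg fun σ _ =>
    mul_nonneg (permWeight_pos hq0 σ).le (sq_nonneg _)) (Real.exp_pos _).le))

theorem exp_mul_factorial_le {n k : ℕ} {S : ℝ} (hS : 1 ≤ S) (hk : 544 * S ≤ k) (hn : 1 ≤ n) :
    64 * (Real.exp (-(((k ^ 4 * n ^ 8 : ℕ) : ℝ) / (32 * S * (n : ℝ) ^ 3))) * (n.factorial : ℝ)) ≤
      (1 / (16 * ((k ^ 4 * n ^ 8 : ℕ) : ℝ))) ^ (n * n) := by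
  have hn' : (1 : ℝ) ≤ n := by exact_mod_cast hn
  have hk' : (1 : ℝ) ≤ k := by linarith
  obtain ⟨X, hX⟩ : ∃ X : ℝ, X = k * (n : ℝ) ^ 2 := ⟨_, rfl⟩
  have hX1 : 1 ≤ X := hX ▸ one_le_mul_of_one_le_of_one_le hk' (one_le_pow₀ hn')
  have hT : ((k ^ 4 * n ^ 8 : ℕ) : ℝ) = X ^ 4 := by
    rw [hX]
    push_cast
    ring
  have h64 : (64 : ℝ) ≤ Real.exp 8 := by
    have h1 : (2 : ℝ) ≤ Real.exp 1 := by linarith [Real.add_one_le_exp (1 : ℝ)]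
    have h2 : Real.exp 8 = Real.exp 1 ^ 8 := by
      rw [← Real.exp_nat_mul]
      norm_num
    rw [h2]
    exact le_trans (by norm_num) (pow_le_pow_left₀ (by norm_num) h1 8)
  have hfac : (n.factorial : ℝ) ≤ Real.exp ((n : ℝ) ^ 2) := by
    have h1 : (n.factorial : ℝ) ≤ (n : ℝ) ^ n := by exact_mod_cast Nat.factorial_le_pow n
    have h2 : (n : ℝ) ^ n ≤ Real.exp n ^ n :=
      pow_le_pow_left₀ (by linarith) (by linarith [Real.add_one_le_exp (n : ℝ)]) n
    rw [← Real.exp_nat_mul, ← sq] at h2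
    exact h1.trans h2
  have hpow : (16 * X ^ 4) ^ (n * n) ≤ Real.exp (8 * X * (n : ℝ) ^ 2) := by
    have h1 : 16 * X ^ 4 ≤ Real.exp (8 * X) := by
      have h2 : 2 * X ≤ Real.exp (2 * X) := by linarith [Real.add_one_le_exp (2 * X)]
      have h3 := pow_le_pow_left₀ (by linarith) h2 4
      rw [← Real.exp_nat_mul] at h3
      calc 16 * X ^ 4 = (2 * X) ^ 4 := by ring
        _ ≤ _ := h3
        _ = _ := by congr 1; push_cast; ring
    have h4 := pow_le_pow_left₀ (by positivity) h1 (n * n)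
    rw [← Real.exp_nat_mul] at h4
    refine h4.trans (le_of_eq ?_)
    congr 1
    push_cast
    ring
  rw [hT, one_div, inv_pow, ← one_div, le_div_iff₀ (by positivity)]
  have hexp : 8 + (n : ℝ) ^ 2 + 8 * X * (n : ℝ) ^ 2 ≤ X ^ 4 / (32 * S * (n : ℝ) ^ 3) := by
    have hn2 : (1 : ℝ) ≤ (n : ℝ) ^ 2 := one_le_pow₀ hn'
    have h1 : 8 + (n : ℝ) ^ 2 + 8 * X * (n : ℝ) ^ 2 ≤ 17 * X * (n : ℝ) ^ 2 := by
      nlinarith [one_le_mul_of_one_le_of_one_le hX1 hn2]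
    refine h1.trans ?_
    rw [le_div_iff₀ (by positivity)]
    calc 17 * X * (n : ℝ) ^ 2 * (32 * S * (n : ℝ) ^ 3) = X * (n : ℝ) ^ 5 * (544 * S) := by ring
      _ ≤ X * (n : ℝ) ^ 5 * k := by gcongr
      _ ≤ X * (n : ℝ) ^ 6 * (k : ℝ) ^ 3 := by
        have e1 : (n : ℝ) ^ 5 ≤ (n : ℝ) ^ 6 := pow_le_pow_right₀ hn' (by norm_num)
        have e2 : (k : ℝ) ≤ (k : ℝ) ^ 3 := le_self_pow₀ hk' (by norm_num)
        gcongr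
      _ = X ^ 4 := by rw [hX]; ring
  calc 64 * (Real.exp (-(X ^ 4 / (32 * S * (n : ℝ) ^ 3))) * (n.factorial : ℝ)) *
        (16 * X ^ 4) ^ (n * n)
      ≤ Real.exp 8 * (Real.exp (-(X ^ 4 / (32 * S * (n : ℝ) ^ 3))) * Real.exp ((n : ℝ) ^ 2)) *
        Real.exp (8 * X * (n : ℝ) ^ 2) := by gcongr
    _ = Real.exp (8 + (n : ℝ) ^ 2 + 8 * X * (n : ℝ) ^ 2 - X ^ 4 / (32 * S * (n : ℝ) ^ 3)) := by
        rw [← Real.exp_add, ← Real.exp_add, ← Real.exp_add]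
        congr 1
        ring
    _ ≤ 1 := Real.exp_le_one_iff.2 (by linarith)

theorem abs_iterate_sub_permMean_le {q : Fin (m + 1) → Fin (m + 1) → ℝ} {qb : ℝ}
    (hq0 : ∀ u v, u < v → 0 < q u v) (hq : ∀ u v, u < v → q u v ≤ qb) (hqb : 1 / 4 ≤ qb)
    (hqb2 : qb < 1 / 2) (hm : 0 < m) {T : STree} (hT : ModularAt q 0 T)
    (hn : T.numLeaves = m + 1) {k : ℕ} (hk : 544 * sortConst qb 4 ≤ k)
    {g : Equiv.Perm (Fin (m + 1)) → ℝ} (hg : ∀ σ, |g σ| ≤ 1) (x : Equiv.Perm (Fin (m + 1))) :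
    |(chainOp q)^[k ^ 4 * (m + 1) ^ 8] g x - permMean q g| ≤ 1 / 2 := by
  have hS := one_le_sortConst (by linarith : 0 ≤ qb) hqb2 3
  obtain ⟨t, ht⟩ : ∃ t, t = k ^ 4 * (m + 1) ^ 8 := ⟨_, rfl⟩
  obtain ⟨δ, hδ⟩ : ∃ δ : ℝ, δ = 1 / (16 * (t : ℝ)) := ⟨_, rfl⟩
  have hk1 : 0 < k := by
    have : (0 : ℝ) < k := by linarith
    exact_mod_cast this
  have ht1 : (1 : ℝ) ≤ t := by
    have : 1 ≤ t := ht ▸ Nat.succ_le_of_lt (by positivity)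
    exact_mod_cast this
  have hδ0 : 0 < δ := by rw [hδ]; positivity
  have hδt : (t : ℝ) * δ = 1 / 16 := by
    rw [hδ]
    field_simp
  have hδ4 : δ ≤ 1 / 4 := by nlinarith
  have hnum := exp_mul_factorial_le (n := m + 1) hS hk (by omega)
  rw [← ht, ← hδ] at hnum
  rw [← ht]
  obtain ⟨q', hq'⟩ : ∃ q' : Fin (m + 1) → Fin (m + 1) → ℝ, q' = fun u v => max (q u v) δ :=
    ⟨_, rfl⟩
  have hq0' : ∀ u v, u < v → 0 < q' u v := fun u v h => by
    rw [hq']; exact lt_max_of_lt_right hδ0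
  have hqb' : ∀ u v, u < v → q' u v ≤ qb := fun u v h => by
    rw [hq']; exact max_le (hq u v h) (by linarith)
  have hT' : ModularAt q' 0 T := hq' ▸ hT.max_const δ
  have hclose : ∀ y, |(chainOp q')^[t] g y - permMean q' g| ≤ 1 / 8 := by
    intro y
    have h1 := permWeight_mul_sq_iterate_sub_le hq0' hqb' (by linarith) hqb2 hm hT' hn hg t y
    have h2 : δ ^ ((m + 1) * (m + 1)) ≤ permWeight q' y :=
      pow_le_permWeight hδ0.le (by linarith) (fun u v _ => by rw [hq']; exact le_max_right _ _) y
    have h3 : ∑ σ, permWeight q' σ ≤ ((m + 1).factorial : ℝ) := by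
      refine (Finset.sum_le_sum fun σ _ => permWeight_le_one hq0'
        (fun u v h => (hqb' u v h).trans (by linarith)) σ).trans ?_
      simp [Fintype.card_perm]
    have h4 := h1.trans (mul_le_mul_of_nonneg_left h3 (Real.exp_pos _).le)
    have h5 := pow_pos hδ0 ((m + 1) * (m + 1))
    push_cast at hnum
    have h6 : δ ^ ((m + 1) * (m + 1)) * (64 * ((chainOp q')^[t] g y - permMean q' g) ^ 2) ≤
        δ ^ ((m + 1) * (m + 1)) * 1 := by
      nlinarith [mul_le_mul_of_nonneg_right h2 (sq_nonneg ((chainOp q')^[t] g y - permMean q' g))]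
    have h7 := le_of_mul_le_mul_left h6 h5
    refine abs_le_of_sq_le_sq ?_ (by norm_num)
    linarith
  have hpert : ∀ y, |(chainOp q)^[t] g y - (chainOp q')^[t] g y| ≤ 1 / 8 := by
    intro y
    refine (abs_iterate_chainOp_sub_le hq0 hq0' hm (δ := δ)
      (hq' ▸ abs_swapProb_sub_max_le hq0 hδ0.le) hg t y).trans ?_
    linarith
  have hboth : ∀ y, |(chainOp q)^[t] g y - permMean q' g| ≤ 1 / 4 := fun y =>
    (abs_sub_le _ ((chainOp q')^[t] g y) _).trans (by linarith [hclose y, hpert y])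
  have hZ := sum_permWeight_pos hq0
  have hmean : |permMean q g - permMean q' g| ≤ 1 / 4 := by
    have h1 : permMean q g - permMean q' g =
        (∑ σ, permWeight q σ * ((chainOp q)^[t] g σ - permMean q' g)) /
          ∑ σ, permWeight q σ := by
      simp only [mul_sub, Finset.sum_sub_distrib, ← Finset.sum_mul]
      rw [sum_iterate_chainOp q hm, permMean, sub_div]
      field_simp
    rw [h1, abs_div, abs_of_pos hZ, div_le_iff₀ hZ, Finset.mul_sum]
    refine (Finset.abs_sum_le_sum_abs _ _).trans (Finset.sum_le_sum fun σ _ => ?_)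
    rw [abs_mul, abs_of_pos (permWeight_pos hq0 σ), mul_comm]
    exact mul_le_mul_of_nonneg_right (hboth σ) (permWeight_pos hq0 σ).le
  rw [abs_sub_comm] at hmean
  exact (abs_sub_le _ (permMean q' g) _).trans (by linarith [hboth x])

theorem abs_iterate_sub_permMean_le_of_le {q : Fin (m + 1) → Fin (m + 1) → ℝ} {qb : ℝ}
    (hq0 : ∀ u v, u < v → 0 < q u v) (hq : ∀ u v, u < v → q u v ≤ qb) (hqb : 1 / 4 ≤ qb)
    (hqb2 : qb < 1 / 2) (hm : 0 < m) {T : STree} (hT : ModularAt q 0 T)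
    (hn : T.numLeaves = m + 1) {k : ℕ} (hk : 544 * sortConst qb 4 ≤ k) {t : ℕ}
    (ht : k ^ 4 * (m + 1) ^ 8 ≤ t) {g : Equiv.Perm (Fin (m + 1)) → ℝ} (hg : ∀ σ, |g σ| ≤ 1)
    (x : Equiv.Perm (Fin (m + 1))) :
    |(chainOp q)^[t] g x - permMean q g| ≤ 1 / 2 := by
  obtain ⟨s, rfl⟩ := Nat.exists_eq_add_of_le ht
  have h1 := abs_iterate_sub_permMean_le hq0 hq hqb hqb2 hm hT hn hk
    (abs_iterate_chainOp_le hq0 hm hg s) x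
  rwa [permMean, sum_iterate_chainOp q hm, ← permMean, ← Function.iterate_add_apply] at h1

theorem mixingTime_le {q : Fin (m + 1) → Fin (m + 1) → ℝ} {t₀ : ℕ}
    (P : Matrix (Equiv.Perm (Fin (m + 1))) (Equiv.Perm (Fin (m + 1))) ℝ)
    (hP : ∀ f, P.mulVec f = chainOp q f)
    (h : ∀ t, t₀ ≤ t → ∀ g : Equiv.Perm (Fin (m + 1)) → ℝ, (∀ σ, |g σ| ≤ 1) →
      ∀ x, |(chainOp q)^[t] g x - permMean q g| ≤ 1 / 2) :
    mixingTime P (fun σ => permWeight q σ / ∑ τ, permWeight q τ) ≤ t₀ := by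
  have hpow : ∀ t f, (P ^ t).mulVec f = (chainOp q)^[t] f := fun t f => by
    induction t with
    | zero => simp
    | succ t ih => rw [pow_succ', ← Matrix.mulVec_mulVec, ih, hP, Function.iterate_succ_apply']
  refine Nat.sInf_le fun x t ht => ?_
  obtain ⟨g, hg⟩ : ∃ g : Equiv.Perm (Fin (m + 1)) → ℝ, g = fun y =>
      if 0 ≤ (P ^ t) x y - permWeight q y / ∑ τ, permWeight q τ then 1 else -1 := ⟨_, rfl⟩
  have hg1 : ∀ σ, |g σ| ≤ 1 := fun σ => by
    rw [hg]
    dsimp only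
    split_ifs <;> simp
  have h1 := h t ht g hg1 x
  have h2 : ∑ y, |(P ^ t) x y - permWeight q y / ∑ τ, permWeight q τ| =
      (chainOp q)^[t] g x - permMean q g := by
    rw [← hpow, permMean, Finset.sum_div, Matrix.mulVec, dotProduct, ← Finset.sum_sub_distrib]
    refine Finset.sum_congr rfl fun y _ => ?_
    have h3 : |(P ^ t) x y - permWeight q y / ∑ τ, permWeight q τ| =
        ((P ^ t) x y - permWeight q y / ∑ τ, permWeight q τ) * g y := by
      rw [hg]
      dsimp only
      split_ifs with h0
      · rw [abs_of_nonneg h0, mul_one]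
      · rw [abs_of_neg (not_le.1 h0), mul_neg_one]
    rw [h3]
    ring
  rw [h2]
  linarith [(abs_le.1 h1).2]

end Mixing

section League

theorem div_add_bounds {x y c : ℝ} (hx : 0 < x) (hxy : x < y) (h : x / y ≤ c) :
    0 < y / (y + x) ∧ y / (y + x) < 1 ∧ (1 - y / (y + x)) / (y / (y + x)) ≤ c := by
  have hy : 0 < y := hx.trans hxy
  refine ⟨by positivity, (div_lt_one (by positivity)).2 (by linarith), ?_⟩
  convert h using 1
  field_simp
  ring

theorem STree.pSwap_bounds {c : ℝ} (T : STree) (hV : T.Valid) (hR : T.RatioBound c) :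
    ∀ i j, i < j → j < T.numLeaves →
      0 < T.pSwap i j ∧ T.pSwap i j < 1 ∧ (1 - T.pSwap i j) / T.pSwap i j ≤ c := by
  induction T with
  | leaf => intro i j hij hj; simp only [STree.numLeaves] at hj; omega
  | node sL sC sR l d r ihl ihd ihr =>
    obtain ⟨h0, hLC, hCR, -, -, hVl, hVd, hVr⟩ := hV
    obtain ⟨hqL, hqC, hRl, hRd, hRr⟩ := hR
    intro i j hij hj
    simp only [STree.numLeaves] at hj
    rw [STree.pSwap]
    split_ifs with h1 h2 h3 h3 h4
    · exact ihl hVl hRl i j hij h1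
    · exact div_add_bounds h0 hLC hqL
    · refine div_add_bounds h0 (hLC.trans hCR) (le_trans ?_ hqL)
      gcongr
      exact h0.trans hLC
    · exact ihd hVd hRd _ _ (by omega) (by omega)
    · exact div_add_bounds (h0.trans hLC) hCR hqC
    · exact ihr hVr hRr _ _ (by omega) (by omega)

/-- The ratios `(1 - p u v) / p u v` of the two outcomes of a comparison. -/
noncomputable def oddsRatio (n : ℕ) (p : ℕ → ℕ → ℝ) (u v : Fin n) : ℝ :=
  (1 - p u v) / p u v

theorem isModule_seg {n : ℕ} {p : ℕ → ℕ → ℝ} {a s : ℕ}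
    (h : ∀ x y, a ≤ x → x < a + s → a ≤ y → y < a + s →
      (∀ u < a, p u x = p u y) ∧ ∀ u, a + s ≤ u → u < n → p x u = p y u) :
    IsModule (oddsRatio n p) (seg a s) := by
  intro x hx y hy u hu
  rw [mem_seg] at hx hy hu
  obtain ⟨h1, h2⟩ := h x y hx.1 hx.2 hy.1 hy.2
  refine ⟨?_, fun hxu => ?_, fun hux => ?_⟩
  · rw [Fin.lt_def, Fin.lt_def]
    omega
  · rw [Fin.lt_def] at hxu
    rw [oddsRatio, oddsRatio, h2 u (by omega) u.isLt]
  · rw [Fin.lt_def] at hux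
    rw [oddsRatio, oddsRatio, h1 u (by omega)]

theorem modularAt_oddsRatio {n : ℕ} {p : ℕ → ℕ → ℝ} (T : STree) : ∀ a,
    (∀ i j, i < j → j < T.numLeaves → p (a + i) (a + j) = T.pSwap i j) →
    (∀ x y, a ≤ x → x < a + T.numLeaves → a ≤ y → y < a + T.numLeaves →
      (∀ u < a, p u x = p u y) ∧ ∀ u, a + T.numLeaves ≤ u → u < n → p x u = p y u) →
    ModularAt (oddsRatio n p) a T := by
  induction T with
  | leaf =>
    intro a _ h
    exact isModule_seg h
  | node sL sC sR l d r ihl ihd ihr =>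
    intro a hp h
    refine ⟨isModule_seg h, ihl a ?_ ?_, ihd _ ?_ ?_, ihr _ ?_ ?_⟩
    all_goals simp only [STree.numLeaves] at h hp
    · intro i j hij hj
      rw [hp i j hij (by omega), STree.pSwap, if_pos hj]
    · intro x y hx hx2 hy hy2
      obtain ⟨h1, h2⟩ := h x y hx (by omega) hy (by omega)
      refine ⟨h1, fun u hu hun => ?_⟩
      by_cases hu2 : a + (l.numLeaves + d.numLeaves + r.numLeaves) ≤ u
      · exact h2 u hu2 hun
      obtain ⟨x, rfl⟩ := Nat.exists_eq_add_of_le hx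
      obtain ⟨y, rfl⟩ := Nat.exists_eq_add_of_le hy
      obtain ⟨u, rfl⟩ := Nat.exists_eq_add_of_le (by omega : a ≤ u)
      rw [hp x u (by omega) (by omega), hp y u (by omega) (by omega), STree.pSwap, STree.pSwap]
      split_ifs <;> first | rfl | omega
    · intro i j hij hj
      rw [add_assoc, add_assoc, hp _ _ (by omega) (by omega), STree.pSwap, if_neg (by omega),
        if_neg (by omega), if_pos (by omega), Nat.add_sub_cancel_left, Nat.add_sub_cancel_left]
    · intro x y hx hx2 hy hy2
      obtain ⟨h1, h2⟩ := h x y (by omega) (by omega) (by omega) (by omega)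
      obtain ⟨x, rfl⟩ := Nat.exists_eq_add_of_le (by omega : a ≤ x)
      obtain ⟨y, rfl⟩ := Nat.exists_eq_add_of_le (by omega : a ≤ y)
      refine ⟨fun u hu => ?_, fun u hu hun => ?_⟩
      · by_cases hu2 : u < a
        · exact h1 u hu2
        obtain ⟨u, rfl⟩ := Nat.exists_eq_add_of_le (by omega : a ≤ u)
        rw [hp u x (by omega) (by omega), hp u y (by omega) (by omega), STree.pSwap, STree.pSwap]
        split_ifs <;> first | rfl | omega
      · by_cases hu2 : a + (l.numLeaves + d.numLeaves + r.numLeaves) ≤ u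
        · exact h2 u hu2 hun
        obtain ⟨u, rfl⟩ := Nat.exists_eq_add_of_le (by omega : a ≤ u)
        rw [hp x u (by omega) (by omega), hp y u (by omega) (by omega), STree.pSwap, STree.pSwap]
        split_ifs <;> first | rfl | omega
    · intro i j hij hj
      have e : ∀ k, l.numLeaves + (d.numLeaves + k) - l.numLeaves - d.numLeaves = k := by omega
      rw [add_assoc, add_assoc, add_assoc, add_assoc, hp _ _ (by omega) (by omega), STree.pSwap,
        if_neg (by omega), if_neg (by omega), if_neg (by omega), if_neg (by omega), e, e]
    · intro x y hx hx2 hy hy2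
      obtain ⟨h1, h2⟩ := h x y (by omega) (by omega) (by omega) (by omega)
      refine ⟨fun u hu => ?_, fun u hu hun => h2 u (by omega) hun⟩
      by_cases hu2 : u < a
      · exact h1 u hu2
      obtain ⟨x, rfl⟩ := Nat.exists_eq_add_of_le (by omega : a ≤ x)
      obtain ⟨y, rfl⟩ := Nat.exists_eq_add_of_le (by omega : a ≤ y)
      obtain ⟨u, rfl⟩ := Nat.exists_eq_add_of_le (by omega : a ≤ u)
      rw [hp u x (by omega) (by omega), hp u y (by omega) (by omega), STree.pSwap, STree.pSwap]
      split_ifs <;> first | rfl | omega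

theorem sum_sum_ite_succ {m : ℕ} (F : Fin (m + 1) → Fin (m + 1) → ℝ) :
    (∑ i : Fin (m + 1), ∑ j : Fin (m + 1), if (j : ℕ) = (i : ℕ) + 1 then F i j else 0) =
      ∑ i : Fin m, F i.castSucc i.succ := by
  rw [Fin.sum_univ_castSucc]
  have hlast : ∑ j : Fin (m + 1), (if (j : ℕ) = (Fin.last m : ℕ) + 1 then F (Fin.last m) j else 0)
      = 0 := by
    refine Finset.sum_eq_zero fun j _ => if_neg ?_
    have := j.isLt
    simp only [Fin.val_last]
    omega
  rw [hlast, add_zero]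
  refine Finset.sum_congr rfl fun i _ => ?_
  rw [Finset.sum_eq_single i.succ]
  · simp
  · intro j _ hj
    refine if_neg fun h => hj (Fin.ext ?_)
    simpa using h
  · simp

/-- The adjacent transposition matrix on `S_n` that orders `u < v` increasingly with
probability `p u v`. -/
noncomputable def orderingP (n : ℕ) (p : ℕ → ℕ → ℝ) :
    Matrix (Equiv.Perm (Fin n)) (Equiv.Perm (Fin n)) ℝ :=
  fun σ τ => (1 / ((n : ℝ) - 1)) *
    ∑ i : Fin n, ∑ j : Fin n,
      if (j : ℕ) = (i : ℕ) + 1 then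
        (p (min (σ i : ℕ) (σ j : ℕ)) (max (σ i : ℕ) (σ j : ℕ))) *
          (if τ = (if (σ i : ℕ) ≤ (σ j : ℕ) then σ else σ * Equiv.swap i j) then 1 else 0)
        + (1 - p (min (σ i : ℕ) (σ j : ℕ)) (max (σ i : ℕ) (σ j : ℕ))) *
          (if τ = (if (σ i : ℕ) ≤ (σ j : ℕ) then σ * Equiv.swap i j else σ) then 1 else 0)
      else 0

theorem orderingP_mulVec {m : ℕ} {p : ℕ → ℕ → ℝ}
    (hp : ∀ i j, i < j → j < m + 1 → 0 < p i j)
    (f : Equiv.Perm (Fin (m + 1)) → ℝ) :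
    (orderingP (m + 1) p).mulVec f = chainOp (oddsRatio (m + 1) p) f := by
  funext σ
  have h1 : ((m + 1 : ℕ) : ℝ) - 1 = m := by push_cast; ring
  simp only [Matrix.mulVec, dotProduct, orderingP, chainOp, h1, mul_assoc]
  rw [← Finset.mul_sum]
  congr 1
  simp only [sum_sum_ite_succ, Finset.sum_mul]
  rw [Finset.sum_comm]
  refine Finset.sum_congr rfl fun i _ => ?_
  have hu : ∀ u v : Fin (m + 1), u < v → 1 / (1 + oddsRatio (m + 1) p u v) = p u v := by
    intro u v h
    have := (hp u v h v.isLt).ne'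
    rw [oddsRatio]
    field_simp
    ring
  have hu2 : ∀ u v : Fin (m + 1), u < v →
      oddsRatio (m + 1) p u v / (1 + oddsRatio (m + 1) p u v) = 1 - p u v := by
    intro u v h
    have := (hp u v h v.isLt).ne'
    rw [oddsRatio]
    field_simp
    ring
  simp only [add_mul, mul_assoc, Finset.sum_add_distrib, ← Finset.mul_sum, ite_mul, one_mul,
    zero_mul, Finset.sum_ite_eq', Finset.mem_univ, if_true]
  rw [stepOp]
  rcases (apply_castSucc_ne_succ σ i).lt_or_gt with h | h
  · have h' := Fin.lt_def.1 h
    rw [if_pos h'.le, if_pos h'.le, min_eq_left h'.le, max_eq_right h'.le, swapProb, if_pos h,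
      hu2 _ _ h, adj]
    ring
  · have h' := Fin.lt_def.1 h
    rw [if_neg h'.not_ge, if_neg h'.not_ge, min_eq_right h'.le, max_eq_left h'.le, swapProb,
      if_neg h.not_gt, hu _ _ h, adj]
    ring

theorem mixingTime_orderingP_le {n : ℕ} {p : ℕ → ℕ → ℝ} {c : ℝ} (hn2 : 2 ≤ n)
    (hp : ∀ i j, i < j → j < n → 0 < p i j ∧ p i j < 1 ∧ (1 - p i j) / p i j ≤ c)
    (hc : 1 / 4 ≤ c) (hc2 : c < 1 / 2) {T : STree} (hT : ModularAt (oddsRatio n p) 0 T)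
    (hn : T.numLeaves = n) {k : ℕ} (hk : 544 * sortConst c 4 ≤ k) :
    mixingTime (orderingP n p) (fun σ => permWeight (oddsRatio n p) σ /
      ∑ τ, permWeight (oddsRatio n p) τ) ≤ k ^ 4 * n ^ 8 := by
  obtain ⟨m, rfl⟩ := Nat.exists_eq_add_of_le' (by omega : 1 ≤ n)
  refine mixingTime_le _ (orderingP_mulVec fun i j hij hj => (hp i j hij hj).1)
    fun t ht g hg x => ?_
  refine abs_iterate_sub_permMean_le_of_le (fun u v h => ?_)
    (fun u v h => (hp u v h v.isLt).2.2) hc hc2 (by omega) hT hn hk ht hg x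
  have := hp u v h v.isLt
  exact div_pos (by linarith) this.1

theorem mixingTime_leagueP_leaf : mixingTime (leagueP .leaf) (treePi .leaf) = 0 := by
  have h0 : leagueP .leaf = 0 := by
    ext σ τ
    simp [leagueP, STree.numLeaves]
  rw [mixingTime, Nat.sInf_eq_zero]
  right
  rw [Set.eq_empty_iff_forall_notMem]
  intro t ht
  have h1 := ht 1 (t + 1) (by omega)
  have h2 : ∀ σ, treePi .leaf σ = 1 := fun σ => by
    have : Subsingleton (Fin STree.leaf.numLeaves) := inferInstanceAs (Subsingleton (Fin 1))
    have : ∀ τ, treeW .leaf τ = 1 := fun τ => by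
      refine Finset.prod_eq_one fun u _ => Finset.prod_eq_one fun v _ => if_neg ?_
      rw [Subsingleton.elim u v]
      simp
    simp [treePi, this]
  have hcard : Fintype.card (Equiv.Perm (Fin STree.leaf.numLeaves)) = 1 := by
    rw [Fintype.card_perm, Fintype.card_fin]
    rfl
  simp only [h0, h2, zero_pow (Nat.succ_ne_zero t), Matrix.zero_apply, zero_sub, abs_neg, abs_one,
    Finset.sum_const, Finset.card_univ, hcard] at h1
  norm_num at h1

theorem mixingTime_leagueP_le {c : ℝ} (hc : 1 / 4 ≤ c) (hc2 : c < 1 / 2) {T : STree}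
    (hV : T.Valid) (hn : 2 ≤ T.numLeaves) (hR : T.RatioBound c) {k : ℕ}
    (hk : 544 * sortConst c 4 ≤ k) :
    mixingTime (leagueP T) (treePi T) ≤ k ^ 4 * T.numLeaves ^ 8 :=
  mixingTime_orderingP_le hn (T.pSwap_bounds hV hR) hc hc2
    (modularAt_oddsRatio T 0 (by simp) fun x y _ _ _ _ =>
      ⟨fun u hu => by omega, fun u hu hun => by omega⟩) rfl hk

theorem STree.RatioBound.mono {c d : ℝ} (hcd : c ≤ d) {T : STree} (h : T.RatioBound c) :
    T.RatioBound d := by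
  induction T with
  | leaf => trivial
  | node sL sC sR l e r ihl ihe ihr =>
    obtain ⟨h1, h2, h3, h4, h5⟩ := h
    exact ⟨h1.trans hcd, h2.trans hcd, ihl h3, ihe h4, ihr h5⟩

end League

/-- For every `qb < 1/2` there is a constant `C > 0` (depending only
on `qb`, a bound on the ratios of the strengths at internal nodes, and not on `n`)
such that for every valid rooted ternary tree `T` with `n` leaves all of whose
strength ratios are at most `qb`, the league hierarchy chain `L₃` on `S_n` has
mixing time `t(L₃) ≤ C·n¹⁴·log n`. -/
theorem league_hierarchy_mixing (qb : ℝ) (hqb : qb < 1 / 2) :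
    ∃ C : ℝ, 0 < C ∧
      ∀ T : STree, T.Valid → T.RatioBound qb →
        (mixingTime (leagueP T) (treePi T) : ℝ) ≤
          C * (T.numLeaves : ℝ) ^ 14 * Real.log (T.numLeaves : ℝ) := by
  have hc : (1 : ℝ) / 4 ≤ max qb (1 / 4) := le_max_right _ _
  have hc2 : max qb (1 / 4) < (1 : ℝ) / 2 := max_lt hqb (by norm_num)
  obtain ⟨k, hk⟩ := exists_nat_ge (544 * sortConst (max qb (1 / 4)) 4)
  have hk0 : (0 : ℝ) < k := by
    have := one_le_sortConst (by linarith : (0 : ℝ) ≤ max qb (1 / 4)) hc2 3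
    linarith
  refine ⟨2 * k ^ 4, by positivity, fun T hV hR => ?_⟩
  cases T with
  | leaf =>
    rw [mixingTime_leagueP_leaf]
    simp [STree.numLeaves]
  | node sL sC sR l c r =>
    have hn : 2 ≤ (STree.node sL sC sR l c r).numLeaves := by
      have h1 := l.numLeaves_pos
      have h2 := c.numLeaves_pos
      rw [STree.numLeaves]
      omega
    have h1 := mixingTime_leagueP_le hc hc2 hV hn (hR.mono (le_max_left _ _)) hk
    generalize mixingTime (leagueP (STree.node sL sC sR l c r)) _ = t at h1 ⊢
    generalize (STree.node sL sC sR l c r).numLeaves = n at hn h1 ⊢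
    have hn' : (2 : ℝ) ≤ n := by exact_mod_cast hn
    have hlog : 1 / 2 ≤ Real.log n := by
      have := Real.log_le_log (by norm_num) hn'
      linarith [Real.log_two_gt_d9]
    calc (t : ℝ) ≤ ((k ^ 4 * n ^ 8 : ℕ) : ℝ) := by exact_mod_cast h1
      _ = 2 * (k : ℝ) ^ 4 * (n : ℝ) ^ 8 * (1 / 2) := by push_cast; ring
      _ ≤ 2 * (k : ℝ) ^ 4 * (n : ℝ) ^ 14 * Real.log n := by
        gcongr
        · linarith
        · norm_num
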